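/- arXiv:2508.03308 — 2 statements merged into one kernel-verified Lean document; each statement's English description precedes it below -/
import Mathlib

section
/- Let d be a prime, let ζ ≠ 1 be a d-th root of unity, and let c_0 ∈ ℂ be a root of the Misiurewicz polynomial G_{d,m,n}^ζ for some integers m ≥ 2 and n ≥ 1. Set K = ℚ(c_0). Suppose α ∈ K satisfies v_𝔭(α) ≥ 2 for some prime ideal 𝔭 ⊂ O_K lying above d. Then the pair (f_{d,c_0}, α) is stable over K, i.e., f_{d,c_0}^k − α is irreducible over K for every k ≥ 1. -/
open Polynomial IntermediateField

noncomputable section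

/-- The value sequence `a_i(c)`: `a_0 = 0`, `a_{i+1} = a_i ^ d + c`. -/
def aSeq (d : ℕ) {F : Type*} [CommRing F] (c : F) : ℕ → F
  | 0 => 0
  | i + 1 => aSeq d c i ^ d + c

/-- The polynomials `a_i ∈ ℤ[c]`: `a_0 = 0`, `a_{i+1} = a_i ^ d + c`. -/
def aPoly (d : ℕ) : ℕ → Polynomial ℤ
  | 0 => 0
  | i + 1 => aPoly d i ^ d + X

/-- Iterates of `f_{d,c} = x^d + c`: `f^0 = x`, `f^{k+1} = f ∘ f^k`. -/
def fIter (d : ℕ) {F : Type*} [CommRing F] (c : F) : ℕ → Polynomial F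
  | 0 => X
  | k + 1 => fIter d c k ^ d + C c

/-- `c₀` is a root of the Gleason polynomial `G_{d,n} = ∏_{k ∣ n} a_k^{μ(n/k)}`. -/
def isGleasonRoot (d n : ℕ) (c₀ : ℂ) : Prop :=
  ∃ g : Polynomial ℤ,
    g * ∏ k ∈ n.divisors, aPoly d k ^ ((-(ArithmeticFunction.moebius (n / k))).toNat)
        = ∏ k ∈ n.divisors, aPoly d k ^ ((ArithmeticFunction.moebius (n / k)).toNat)
    ∧ Polynomial.aeval c₀ g = 0

/-- `c₀` is a root of the Misiurewicz polynomial `G_{d,m,n}^ζ`. -/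
def isMisiurewiczRoot (d m n : ℕ) (ζ c₀ : ℂ) : Prop :=
  ∃ g : Polynomial ℂ,
    g * ((∏ k ∈ n.divisors,
            ((aPoly d (m + k - 1)).map (Int.castRingHom ℂ) -
              C ζ * (aPoly d (m - 1)).map (Int.castRingHom ℂ))
                ^ ((-(ArithmeticFunction.moebius (n / k))).toNat)) *
          (if n ∣ (m - 1) then
            ∏ k ∈ n.divisors, ((aPoly d k).map (Int.castRingHom ℂ))
                ^ ((ArithmeticFunction.moebius (n / k)).toNat)
          else 1))
        = (∏ k ∈ n.divisors,
            ((aPoly d (m + k - 1)).map (Int.castRingHom ℂ) -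
              C ζ * (aPoly d (m - 1)).map (Int.castRingHom ℂ))
                ^ ((ArithmeticFunction.moebius (n / k)).toNat)) *
          (if n ∣ (m - 1) then
            ∏ k ∈ n.divisors, ((aPoly d k).map (Int.castRingHom ℂ))
                ^ ((-(ArithmeticFunction.moebius (n / k))).toNat)
          else 1)
    ∧ g.eval c₀ = 0

/-- The polynomial `F_{k,i}^{(d,c₀)} = ∏_{j=1}^{d-1} (f_{d,c₀}^k - ζ^j a_i(c₀))` over `ℂ`. -/
def FPoly (d : ℕ) (c₀ ζ : ℂ) (k i : ℕ) : Polynomial ℂ :=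
  ∏ j ∈ Finset.Icc 1 (d - 1), (fIter d c₀ k - C (ζ ^ j * aSeq d c₀ i))

section Orbit

variable {A : Type*} [CommRing A] {d : ℕ} {c : A}

theorem aSeq_map {B : Type*} [CommRing B] (φ : A →+* B) (i : ℕ) :
    φ (aSeq d c i) = aSeq d (φ c) i := by
  induction i with
  | zero => simp [aSeq]
  | succ i ih => simp [aSeq, ih]

theorem aSeq_eq_aeval_aPoly (i : ℕ) : aSeq d c i = aeval c (aPoly d i) := by
  induction i with
  | zero => simp [aSeq, aPoly]
  | succ i ih => simp [aSeq, aPoly, ih]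

theorem exists_aSeq_add (hd : d.Prime) (c : A) (i j : ℕ) :
    ∃ y, aSeq d c (i + j) = aSeq d c j + aSeq d c i ^ d ^ j + d * aSeq d c i ^ 2 * y := by
  induction j with
  | zero => exact ⟨0, by simp [aSeq]⟩
  | succ j ih =>
    obtain ⟨y, hy⟩ := ih
    obtain ⟨e, rfl⟩ : ∃ e, d = e + 2 := ⟨d - 2, by have := hd.two_le; omega⟩
    set D := e + 2 with hD
    set a := aSeq D c i
    obtain ⟨r, hr⟩ := exists_add_pow_prime_eq hd (a ^ D ^ j) (D * a ^ 2 * y)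
    obtain ⟨r', hr'⟩ := exists_add_pow_prime_eq hd (aSeq D c j) (a ^ D ^ j + D * a ^ 2 * y)
    have hz : ∃ z, (D : A) * aSeq D c j * (a ^ D ^ j + D * a ^ 2 * y) = D * a ^ 2 * z := by
      rcases Nat.eq_zero_or_pos j with rfl | hj
      · exact ⟨0, by simp [aSeq]⟩
      · obtain ⟨t, ht⟩ : a ^ 2 ∣ a ^ D ^ j :=
          pow_dvd_pow a (hd.two_le.trans (Nat.le_self_pow hj.ne' D))
        exact ⟨aSeq D c j * (t + D * y), by rw [ht]; ring⟩
    obtain ⟨z, hz⟩ := hz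
    refine ⟨z * r' + a ^ D ^ j * D * y * r + (D * a ^ 2 * y) ^ (e + 1) * y, ?_⟩
    have : aSeq D c (i + (j + 1)) = aSeq D c (i + j) ^ D + c := rfl
    rw [this, hy, add_assoc, hr', hr, hz, show aSeq D c (j + 1) = aSeq D c j ^ D + c from rfl,
      pow_succ D j, pow_mul, show (D * a ^ 2 * y) ^ D = (D * a ^ 2 * y) ^ (e + 1) * (D * a ^ 2 * y)
        from pow_succ _ _]
    ring

theorem dvd_aSeq_add_sub (hd : d.Prime) (c : A) (i j : ℕ) :
    aSeq d c i ∣ aSeq d c (i + j) - aSeq d c j := by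
  obtain ⟨y, hy⟩ := exists_aSeq_add hd c i j
  obtain ⟨t, ht⟩ := dvd_pow_self (aSeq d c i) (pow_ne_zero j hd.ne_zero)
  exact ⟨t + d * aSeq d c i * y, by rw [hy, ht]; ring⟩

theorem exists_aSeq_add_mul_eq (hd : d.Prime) (c : A) (p k : ℕ) :
    ∃ y, aSeq d c ((k + 1) * p) = aSeq d c p * (1 + aSeq d c p * y) := by
  induction k with
  | zero => exact ⟨0, by simp⟩
  | succ k ih =>
    obtain ⟨y, hy⟩ := ih
    rcases Nat.eq_zero_or_pos p with rfl | hp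
    · exact ⟨0, by simp⟩
    obtain ⟨z, hz⟩ := exists_aSeq_add hd c p ((k + 1) * p)
    obtain ⟨t, ht⟩ : aSeq d c p ^ 2 ∣ aSeq d c p ^ d ^ ((k + 1) * p) :=
      pow_dvd_pow _ (hd.two_le.trans (Nat.le_self_pow (by positivity) d))
    refine ⟨y + t + d * z, ?_⟩
    rw [show (k + 1 + 1) * p = p + (k + 1) * p by ring, hz, ht, hy]
    ring

theorem iff_dvd_of_add_iff {Z : ℕ → Prop} {p : ℕ} (hp : 0 < p) (h0 : Z 0)
    (hadd : ∀ j, Z (p + j) ↔ Z j) (hmin : ∀ j, 0 < j → j < p → ¬ Z j) (j : ℕ) :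
    Z j ↔ p ∣ j := by
  induction j using Nat.strong_induction_on with
  | _ j ih =>
    rcases lt_or_ge j p with h | h
    · rcases Nat.eq_zero_or_pos j with rfl | hj
      · simp [h0]
      · exact iff_of_false (hmin j hj h) (Nat.not_dvd_of_pos_of_lt hj h)
    · obtain ⟨k, rfl⟩ := Nat.exists_eq_add_of_le h
      rw [hadd, ih k (by omega), Nat.dvd_add_right dvd_rfl]

theorem exists_pos_forall_mem_iff_dvd (hd : d.Prime) (I : Ideal A) (c : A) {N : ℕ} (hN : 0 < N)
    (hmem : aSeq d c N ∈ I) : ∃ p, 0 < p ∧ ∀ j, aSeq d c j ∈ I ↔ p ∣ j := by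
  classical
  have hex : ∃ p, 0 < p ∧ aSeq d c p ∈ I := ⟨N, hN, hmem⟩
  refine ⟨Nat.find hex, (Nat.find_spec hex).1, fun j ↦
    iff_dvd_of_add_iff (Z := fun j ↦ aSeq d c j ∈ I) (Nat.find_spec hex).1 (by simp [aSeq])
      (fun j ↦ ?_) (fun j hj hlt h ↦ Nat.find_min hex hlt ⟨hj, h⟩) j⟩
  have h : aSeq d c (Nat.find hex + j) - aSeq d c j ∈ I :=
    I.mem_of_dvd (dvd_aSeq_add_sub hd c _ j) (Nat.find_spec hex).2
  exact ⟨fun h' ↦ by simpa using I.sub_mem h' h, fun h' ↦ by simpa using I.add_mem h h'⟩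

end Orbit

section RootOfUnity

variable {A : Type*} [CommRing A] {d : ℕ} {ζ : A}

theorem one_sub_dvd_natCast_of_pow_eq_one [IsDomain A] (hζ : ζ ^ d = 1) (hζ1 : ζ ≠ 1) :
    1 - ζ ∣ (d : A) := by
  have h0 : ∑ i ∈ Finset.range d, ζ ^ i = 0 := by
    have := geom_sum_mul ζ d
    rw [hζ, sub_self] at this
    exact (mul_eq_zero.1 this).resolve_right (sub_ne_zero.2 hζ1)
  have : (d : A) = ∑ i ∈ Finset.range d, (1 - ζ ^ i) := by simp [h0]
  rw [this]
  exact Finset.dvd_sum fun i _ ↦ by simpa using sub_dvd_pow_sub_pow 1 ζ i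

theorem one_sub_mem_of_pow_eq_one (hd : d.Prime) (hζ : ζ ^ d = 1) {I : Ideal A} [I.IsPrime]
    (hI : (d : A) ∈ I) : 1 - ζ ∈ I := by
  obtain ⟨r, hr⟩ := exists_add_pow_prime_eq hd (1 - ζ) ζ
  have : (1 - ζ) ^ d = d * (-((1 - ζ) * ζ * r)) := by
    rw [sub_add_cancel, one_pow, hζ] at hr
    linear_combination -hr
  exact Ideal.IsPrime.mem_of_pow_mem ‹_› d (this ▸ I.mul_mem_right _ hI)

end RootOfUnity

section Uniformizer

variable {A : Type*} [CommRing A] [IsDomain A] {d : ℕ} {c ζ : A}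

theorem exists_notMem_dvd_mul_one_sub (hd : d.Prime) (hζ : ζ ^ d = 1) (hζ1 : ζ ≠ 1)
    {I : Ideal A} [I.IsPrime] {m N p : ℕ} (hm : 0 < m) (hN : 0 < N)
    (hrel : aSeq d c (N + m) = ζ * aSeq d c m) (hp0 : aSeq d c p ≠ 0)
    (hmem : ∀ j, aSeq d c j ∈ I ↔ p ∣ j) (hpN : p ∣ N) :
    ∃ s ∉ I, aSeq d c p ∣ s * (1 - ζ) := by
  obtain ⟨w, hw⟩ := one_sub_dvd_natCast_of_pow_eq_one hζ hζ1
  obtain ⟨y, hy⟩ := exists_aSeq_add hd c N m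
  have hπ : aSeq d c p ∈ I := (hmem p).2 dvd_rfl
  have hdvd : ∀ j, 0 < j → p ∣ j → ∃ y, aSeq d c j = aSeq d c p * (1 + aSeq d c p * y) := by
    rintro j hj ⟨k, rfl⟩
    obtain ⟨k, rfl⟩ := Nat.exists_eq_succ_of_ne_zero (n := k) (by rintro rfl; simp at hj)
    simpa [mul_comm] using exists_aSeq_add_mul_eq hd c p k
  obtain ⟨b, hb⟩ := hdvd N hN hpN
  obtain ⟨t, ht⟩ : aSeq d c N ^ 2 ∣ aSeq d c N ^ d ^ m :=
    pow_dvd_pow _ (hd.two_le.trans (Nat.le_self_pow hm.ne' d))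
  set π := aSeq d c p
  set u := 1 + π * b
  have key : (aSeq d c m + π * (π * u ^ 2 * w * y)) * (1 - ζ) = π * (-(π * u ^ 2 * t)) := by
    rw [hrel, ht, hb, hw] at hy
    linear_combination -hy
  by_cases hmI : aSeq d c m ∈ I
  · obtain ⟨z, hz⟩ := hdvd m hm ((hmem m).1 hmI)
    refine ⟨1 + π * (z + u ^ 2 * w * y), fun h ↦ ?_, -(u ^ 2 * t), ?_⟩
    · exact (Ideal.ne_top_iff_one I).1 (Ideal.IsPrime.ne_top ‹_›)
        ((I.add_mem_iff_left (I.mul_mem_right _ hπ)).1 h)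
    · rw [hz] at key
      refine mul_left_cancel₀ hp0 ?_
      linear_combination key
  · exact ⟨_, fun h ↦ hmI ((I.add_mem_iff_left (I.mul_mem_right _ hπ)).1 h), _, key⟩

theorem aPoly_map_separable (d : ℕ) {p : ℕ} (hp : 0 < p) :
    ((aPoly d p).map (Int.castRingHom (ZMod d))).Separable := by
  obtain ⟨i, rfl⟩ := Nat.exists_eq_succ_of_ne_zero hp.ne'
  have : derivative ((aPoly d (i + 1)).map (Int.castRingHom (ZMod d))) = 1 := by
    simp [aPoly, derivative_pow]
  rw [Nat.succ_eq_add_one, separable_def, this]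
  exact isCoprime_one_right

theorem exists_dvd_mul_one_sub_pow {F : Type*} [Field F] [Finite F] {f : F[X]}
    (hf : f.Separable) (h : F[X]) : ∃ M, 0 < M ∧ f ∣ h * (1 - h ^ M) := by
  have : Finite (AdjoinRoot f) := by
    have := (AdjoinRoot.powerBasis hf.ne_zero).finite
    exact Module.finite_of_finite F
  obtain ⟨a, b, hab, heq⟩ := Finite.exists_ne_map_eq_of_infinite
    (fun n : ℕ ↦ AdjoinRoot.mk f h ^ n)
  wlog hlt : a < b generalizing a b
  · exact this b a hab.symm heq.symm (by omega)
  refine ⟨b - a, by omega, ?_⟩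
  have hrad := (isRadical_iff_squarefree_of_ne_zero hf.ne_zero).2 hf.squarefree
  refine hrad (a + 1) _ ?_
  have h1 : f ∣ h ^ a - h ^ b := by
    rw [← AdjoinRoot.mk_eq_mk]
    simpa using heq
  have h2 : h ^ a - h ^ b = h ^ a * (1 - h ^ (b - a)) := by
    rw [mul_sub, mul_one, ← pow_add, Nat.add_sub_cancel' hlt.le]
  refine h1.trans ?_
  rw [h2, mul_pow]
  exact mul_dvd_mul (pow_dvd_pow _ (by omega)) (dvd_pow_self _ (by omega))

theorem exists_int_mul_one_sub_pow_eq (hd : d.Prime) {p : ℕ} (hp : 0 < p) (h : ℤ[X]) :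
    ∃ M w z, 0 < M ∧ h * (1 - h ^ M) = aPoly d p * w + C (d : ℤ) * z := by
  have := Fact.mk hd
  obtain ⟨M, hM, w, hw⟩ := exists_dvd_mul_one_sub_pow (aPoly_map_separable d hp)
    (h.map (Int.castRingHom (ZMod d)))
  obtain ⟨w, rfl⟩ := map_surjective _ (ZMod.ringHom_surjective (Int.castRingHom (ZMod d))) w
  have : C (d : ℤ) ∣ h * (1 - h ^ M) - aPoly d p * w := by
    rw [C_dvd_iff_dvd_coeff]
    intro i
    rw [← ZMod.intCast_zmod_eq_zero_iff_dvd]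
    have := congrArg (fun q ↦ coeff q i) (sub_eq_zero.2 hw)
    rw [← coeff_zero i, ← this, ← eq_intCast (Int.castRingHom (ZMod d)), ← coeff_map]
    simp
  obtain ⟨z, hz⟩ := this
  exact ⟨M, w, z, hM, by linear_combination hz⟩

theorem exists_notMem_aSeq_dvd_mul (hd : d.Prime) (hζ : ζ ^ d = 1) (hζ1 : ζ ≠ 1)
    (hgen : ∀ x : A, ∃ (h : ℤ[X]) (y : A), x = aeval c h + (1 - ζ) * y)
    {I : Ideal A} [I.IsPrime] (hdI : (d : A) ∈ I) {m N : ℕ} (hm : 0 < m) (hN : 0 < N)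
    (hrel : aSeq d c (N + m) = ζ * aSeq d c m) (hne : ∀ j, 0 < j → aSeq d c j ≠ 0) :
    ∃ p, 0 < p ∧ aSeq d c p ∈ I ∧ ∀ x ∈ I, ∃ s ∉ I, aSeq d c p ∣ s * x := by
  have hζI := one_sub_mem_of_pow_eq_one hd hζ hdI
  obtain ⟨w, hw⟩ := one_sub_dvd_natCast_of_pow_eq_one hζ hζ1
  have hNI : aSeq d c N ∈ I := by
    obtain ⟨y, hy⟩ := exists_aSeq_add hd c N m
    refine Ideal.IsPrime.mem_of_pow_mem ‹_› (d ^ m) ?_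
    have : aSeq d c N ^ d ^ m = (1 - ζ) * (-(aSeq d c m) - w * aSeq d c N ^ 2 * y) := by
      rw [hrel, hw] at hy
      linear_combination -hy
    exact this ▸ I.mul_mem_right _ hζI
  obtain ⟨p, hp, hmem⟩ := exists_pos_forall_mem_iff_dvd hd I c hN hNI
  obtain ⟨s, hs, t, ht⟩ := exists_notMem_dvd_mul_one_sub hd hζ hζ1 hm hN hrel (hne p hp) hmem
    ((hmem N).1 hNI)
  refine ⟨p, hp, (hmem p).2 dvd_rfl, fun x hx ↦ ?_⟩
  obtain ⟨h, y, rfl⟩ := hgen x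
  have hh : aeval c h ∈ I := (I.add_mem_iff_left (I.mul_mem_right _ hζI)).1 hx
  obtain ⟨M, u, z, hM, hu⟩ := exists_int_mul_one_sub_pow_eq hd hp h
  replace hu := congrArg (aeval c) hu
  simp only [map_mul, map_sub, map_one, map_pow, map_add, ← aSeq_eq_aeval_aPoly,
    map_natCast] at hu
  refine ⟨s * (1 - aeval c h ^ M), fun hc ↦ ?_,
    s * aeval c u + t * (w * aeval c z + (1 - aeval c h ^ M) * y), ?_⟩
  · rcases Ideal.IsPrime.mem_or_mem ‹_› hc with hc | hc
    · exact hs hc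
    · refine (Ideal.ne_top_iff_one I).1 (Ideal.IsPrime.ne_top ‹_›) ?_
      simpa using I.add_mem hc (I.pow_mem_of_mem hh M hM)
  · rw [hw] at hu
    linear_combination s * hu + (w * aeval c z + (1 - aeval c h ^ M) * y) * ht

end Uniformizer

section Valuation

open WithZero

variable {K : Type*} [Field K]

theorem valuation_eq_exp_neg_one_of_generates {A : Type*} [CommRing A] [Algebra A K]
    (v : Valuation K (WithZero (Multiplicative ℤ))) (hv : ∀ a : A, v (algebraMap A K a) ≤ 1)
    (hfrac : ∀ x : K, ∃ a b : A, algebraMap A K b ≠ 0 ∧ x * algebraMap A K b = algebraMap A K a)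
    {π : A} (hπ0 : algebraMap A K π ≠ 0) (hπ : v (algebraMap A K π) < 1)
    (hstep : ∀ x : A, v (algebraMap A K x) < 1 →
      ∃ s : A, v (algebraMap A K s) = 1 ∧ π ∣ s * x)
    (hunif : ∃ x, v x = exp (-1 : ℤ)) : v (algebraMap A K π) = exp (-1 : ℤ) := by
  have hexp : ∀ x : A, algebraMap A K x ≠ 0 → ∃ k : ℕ, v (algebraMap A K x) = exp (-(k : ℤ)) := by
    intro x hx
    have hx' := (Valuation.ne_zero_iff v).2 hx
    have h := hv x
    rw [← exp_log hx'] at h ⊢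
    rw [← exp_zero, exp_le_exp] at h
    exact ⟨(-log (v (algebraMap A K x))).toNat, by rw [Int.toNat_of_nonneg (by omega), neg_neg]⟩
  obtain ⟨e, he⟩ := hexp π hπ0
  have he0 : 0 < e := by
    rw [he, ← exp_zero, exp_lt_exp] at hπ
    omega
  have hpow : ∀ k : ℕ, ∀ x : A, v (algebraMap A K x) = exp (-(k : ℤ)) → e ∣ k := by
    intro k
    induction k using Nat.strong_induction_on with
    | _ k ih =>
      intro x hx
      rcases Nat.eq_zero_or_pos k with rfl | hk
      · simp
      obtain ⟨s, hs, t, ht⟩ := hstep x (by rw [hx, ← exp_zero, exp_lt_exp]; omega)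
      have hmul := congrArg (fun a ↦ v (algebraMap A K a)) ht
      simp only [map_mul, hs, one_mul, hx, he] at hmul
      have ht0 : algebraMap A K t ≠ 0 := by
        intro h
        simp [h] at hmul
      obtain ⟨l, hl⟩ := hexp t ht0
      rw [hl, ← exp_add, exp_inj] at hmul
      have : k = e + l := by omega
      rw [this]
      exact (Nat.dvd_add_right dvd_rfl).2 (ih l (by omega) t hl)
  obtain ⟨x, hx⟩ := hunif
  obtain ⟨a, b, hb, hab⟩ := hfrac x
  have hx0 : x ≠ 0 := by
    rintro rfl
    rw [map_zero] at hx
    exact exp_ne_zero hx.symm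
  obtain ⟨k, hk⟩ := hexp a (hab ▸ mul_ne_zero hx0 hb)
  obtain ⟨l, hl⟩ := hexp b hb
  have hkl := congrArg v hab
  rw [map_mul, hx, hk, hl, ← exp_add, exp_inj] at hkl
  have h1 : k = l + 1 := by omega
  have h2 : e ∣ 1 := (Nat.dvd_add_right (hpow l b hl)).1 (h1 ▸ hpow k a hk)
  rw [he, Nat.dvd_one.1 h2]
  rfl

theorem fIter_map {A B : Type*} [CommRing A] [CommRing B] (φ : A →+* B) (d : ℕ) (c : A) (k : ℕ) :
    (fIter d c k).map φ = fIter d (φ c) k := by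
  induction k with
  | zero => simp [fIter]
  | succ k ih => simp [fIter, ih]

theorem fIter_eval_aSeq {A : Type*} [CommRing A] (d : ℕ) (c : A) (k j : ℕ) :
    (fIter d c k).eval (aSeq d c j) = aSeq d c (j + k) := by
  induction k with
  | zero => simp [fIter]
  | succ k ih => simp [fIter, ih, aSeq]

theorem fIter_eq_of_charP {A : Type*} [CommRing A] (d : ℕ) [Fact d.Prime] [CharP A d] (c : A)
    (k : ℕ) : fIter d c k = X ^ d ^ k + C (aSeq d c k) := by
  induction k with
  | zero => simp [fIter, aSeq]
  | succ k ih => simp [fIter, aSeq, ih, add_pow_char, pow_succ, pow_mul, add_assoc]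

theorem fIter_monic_natDegree {A : Type*} [CommRing A] [Nontrivial A] {d : ℕ} (hd : d ≠ 0) (c : A)
    (k : ℕ) : (fIter d c k).Monic ∧ (fIter d c k).natDegree = d ^ k := by
  induction k with
  | zero => simp [fIter]
  | succ k ih =>
    have h : (fIter d c k ^ d).natDegree = d ^ (k + 1) := by
      rw [ih.1.natDegree_pow, ih.2, pow_succ, mul_comm]
    have hlt : (C c).degree < (fIter d c k ^ d).degree := by
      rw [degree_eq_natDegree (ih.1.pow d).ne_zero, h]
      exact degree_C_le.trans_lt (by exact_mod_cast Nat.pos_of_ne_zero (pow_ne_zero _ hd))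
    exact ⟨(ih.1.pow d).add_of_left hlt, by
      rw [fIter, natDegree_add_eq_left_of_degree_lt hlt, h]⟩

theorem fIter_sub_C_monic_natDegree {A : Type*} [CommRing A] [Nontrivial A] {d : ℕ} (hd : d ≠ 0)
    (c α : A) (k : ℕ) :
    (fIter d c k - C α).Monic ∧ (fIter d c k - C α).natDegree = d ^ k := by
  obtain ⟨h1, h2⟩ := fIter_monic_natDegree hd c k
  refine ⟨h1.sub_of_left ?_, by rw [natDegree_sub_C, h2]⟩
  rw [degree_eq_natDegree h1.ne_zero, h2]
  exact degree_C_le.trans_lt (by exact_mod_cast Nat.pos_of_ne_zero (pow_ne_zero _ hd))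

theorem irreducible_fIter_sub_C_of_isLocalRing {V : Type*} [CommRing V] [IsDomain V]
    [IsLocalRing V] {d : ℕ} (hd : d.Prime) (hdV : (d : V) ∈ IsLocalRing.maximalIdeal V)
    (c α : V) (k j : ℕ) (hmem : aSeq d c (j + k) - α ∈ IsLocalRing.maximalIdeal V)
    (hnot : aSeq d c (j + k) - α ∉ IsLocalRing.maximalIdeal V ^ 2) :
    Irreducible (fIter d c k - C α) := by
  have := Fact.mk hd
  have hmon := fIter_sub_C_monic_natDegree hd.ne_zero c α k
  rw [← MulEquiv.irreducible_iff (taylorEquiv (aSeq d c j))]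
  set q := taylorEquiv (aSeq d c j) (fIter d c k - C α)
  have hqt : q = taylor (aSeq d c j) (fIter d c k - C α) := rfl
  have hq0 : q.coeff 0 = aSeq d c (j + k) - α := by
    rw [hqt, taylor_coeff_zero, eval_sub, fIter_eval_aSeq, eval_C]
  have hqdeg : q.natDegree = d ^ k := by rw [hqt, natDegree_taylor, hmon.2]
  have hqmon : q.Monic := by
    rw [hqt]
    rw [Monic, leadingCoeff_taylor, hmon.1]
  have : CharP (IsLocalRing.ResidueField V) d := by
    refine (CharP.charP_iff_prime_eq_zero hd).2 ?_
    rw [← map_natCast (IsLocalRing.residue V), IsLocalRing.residue_eq_zero_iff]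
    exact hdV
  have hmap : q.map (IsLocalRing.residue V) = X ^ d ^ k := by
    have h0 : (q.map (IsLocalRing.residue V)).coeff 0 = 0 := by
      rwa [coeff_map, hq0, IsLocalRing.residue_eq_zero_iff]
    have h1 : ∃ b, q.map (IsLocalRing.residue V) = X ^ d ^ k + C b := by
      refine ⟨IsLocalRing.residue V (aSeq d c j) ^ d ^ k +
        (aSeq d (IsLocalRing.residue V c) k - IsLocalRing.residue V α), ?_⟩
      rw [hqt, taylor_apply, Polynomial.map_comp, Polynomial.map_sub, fIter_map,
        fIter_eq_of_charP]
      simp only [Polynomial.map_add, map_X, map_C, add_comp, pow_comp, X_comp, C_comp,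
        add_pow_char_pow, ← C_pow, add_assoc, add_sub_assoc, ← C_sub, ← C_add]
    obtain ⟨b, hb⟩ := h1
    rw [hb, coeff_add, coeff_X_pow, if_neg (pow_pos hd.pos k).ne, zero_add, coeff_C_zero] at h0
    rw [hb, h0, C_0, add_zero]
  refine IsEisensteinAt.irreducible (𝓟 := IsLocalRing.maximalIdeal V)
    ⟨?_, fun {n} hn ↦ ?_, hq0 ▸ hnot⟩ inferInstance hqmon.isPrimitive
    (by rw [hqdeg]; exact pow_pos hd.pos k)
  · rw [hqmon.leadingCoeff]
    exact (Ideal.ne_top_iff_one _).1 (Ideal.IsPrime.ne_top inferInstance)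
  · rw [← IsLocalRing.residue_eq_zero_iff, ← coeff_map, hmap, coeff_X_pow, if_neg]
    omega

theorem irreducible_fIter_sub_C_of_valuation (v : Valuation K (WithZero (Multiplicative ℤ)))
    {d : ℕ} (hd : d.Prime) (hdv : v d < 1) {c α : K} (hc : v c ≤ 1)
    (hα : v α ≤ exp (-2 : ℤ)) {p : ℕ} (hp : 0 < p) (hpv : v (aSeq d c p) = exp (-1 : ℤ)) (k : ℕ) :
    Irreducible (fIter d c k - C α) := by
  let V := v.valuationSubring
  have hlt : ∀ x : V, x ∈ IsLocalRing.maximalIdeal V ↔ v x < 1 := fun _ ↦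
    Valuation.mem_maximalIdeal_iff K v
  have hα1 : v α ≤ 1 := hα.trans (by rw [← exp_zero, exp_le_exp]; norm_num)
  let c' : V := ⟨c, hc⟩
  let α' : V := ⟨α, hα1⟩
  have hseq : ∀ i, ((aSeq d c' i : V) : K) = aSeq d c i := fun i ↦ aSeq_map V.subtype i
  have hv1 : v (aSeq d c ((k + 1) * p) - α) = exp (-1 : ℤ) := by
    obtain ⟨y, hy⟩ := exists_aSeq_add_mul_eq hd c' p k
    have hy' := congrArg (Subtype.val) hy
    push_cast [hseq] at hy'
    have hy1 : v (y : K) ≤ 1 := y.2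
    have h1 : v (1 + aSeq d c p * y) = 1 := by
      refine v.map_one_add_of_lt ?_
      rw [map_mul, hpv]
      refine (mul_le_of_le_one_right' hy1).trans_lt ?_
      rw [← exp_zero, exp_lt_exp]; norm_num
    have h2 : v (aSeq d c ((k + 1) * p)) = exp (-1 : ℤ) := by
      rw [hy', map_mul, h1, hpv, mul_one]
    rw [Valuation.map_sub_eq_of_lt_left, h2]
    rw [h2]
    refine hα.trans_lt ?_
    rw [exp_lt_exp]; norm_num
  have hjk : (k + 1) * p - k + k = (k + 1) * p := Nat.sub_add_cancel (by nlinarith)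
  have hirr : Irreducible (fIter d c' k - C α') := by
    refine irreducible_fIter_sub_C_of_isLocalRing hd ?_ c' α' k ((k + 1) * p - k) ?_ ?_
    · rw [hlt]
      simpa using hdv
    · rw [hlt, hjk]
      push_cast [hseq]
      rw [hv1, ← exp_zero, exp_lt_exp]; norm_num
    · intro h
      have hsq : ∀ x ∈ IsLocalRing.maximalIdeal V ^ 2, v (x : K) ≤ exp (-2 : ℤ) := by
        have hle : ∀ x : V, v (x : K) < 1 → v (x : K) ≤ exp (-1 : ℤ) := by
          intro x hx
          rcases eq_or_ne (v (x : K)) 0 with h0 | h0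
          · simp [h0]
          rw [← exp_log h0] at hx ⊢
          rw [← exp_zero, exp_lt_exp] at hx
          rw [exp_le_exp]
          omega
        intro x hx
        rw [pow_two] at hx
        refine Submodule.mul_induction_on hx (fun a ha b hb ↦ ?_) (fun a b ha hb ↦ ?_)
        · push_cast
          rw [map_mul, show (-2 : ℤ) = -1 + -1 by norm_num, exp_add]
          exact mul_le_mul' (hle a ((hlt a).1 ha)) (hle b ((hlt b).1 hb))
        · push_cast
          exact v.map_add_le ha hb
      have := hsq _ h
      rw [hjk] at this
      push_cast [hseq] at this
      rw [hv1, exp_le_exp] at this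
      norm_num at this
  have := ((fIter_sub_C_monic_natDegree hd.ne_zero c' α'
    k).1.irreducible_iff_irreducible_map_fraction_map (K := K)).1 hirr
  rwa [Polynomial.map_sub, fIter_map, map_C] at this

end Valuation

section Periodic

variable {A : Type*} [CommRing A] {d : ℕ} {c : A}

theorem aSeq_add_eq_of_eq_zero (hd : d.Prime) {k : ℕ} (hk : aSeq d c k = 0) (j : ℕ) :
    aSeq d c (k + j) = aSeq d c j := by
  have := dvd_aSeq_add_sub hd c k j
  rwa [hk, zero_dvd_iff, sub_eq_zero] at this

theorem aSeq_add_eq_mul_iff [IsDomain A] (hd : d.Prime) {ζ : A} (hζ : ζ ^ d = 1) (hζ1 : ζ ≠ 1)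
    {p : ℕ} (hp : 0 < p) (hper : ∀ j, aSeq d c j = 0 ↔ p ∣ j) {m k : ℕ} :
    aSeq d c (k + m) = ζ * aSeq d c m ↔ p ∣ m ∧ p ∣ k := by
  refine ⟨fun h ↦ ?_, fun ⟨h1, h2⟩ ↦ ?_⟩
  · have hshift : ∀ t, aSeq d c (k + m + 1 + t) = aSeq d c (m + 1 + t) := by
      intro t
      induction t with
      | zero => simp [aSeq, h, mul_pow, hζ]
      | succ t ih => exact congrArg (fun x ↦ x ^ d + c) ih
    have h1 := hshift (p - 1)
    rw [show k + m + 1 + (p - 1) = p + (k + m) by omega, show m + 1 + (p - 1) = p + m by omega,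
      aSeq_add_eq_of_eq_zero hd ((hper p).2 dvd_rfl),
      aSeq_add_eq_of_eq_zero hd ((hper p).2 dvd_rfl)] at h1
    have hm : aSeq d c m = 0 := by
      have : (1 - ζ) * aSeq d c m = 0 := by linear_combination h - h1
      exact (mul_eq_zero.1 this).resolve_left (sub_ne_zero.2 hζ1.symm)
    have hpm := (hper m).1 hm
    exact ⟨hpm, (Nat.dvd_add_left hpm).1 ((hper (k + m)).1 (h1.trans hm))⟩
  · rw [(hper m).2 h1, (hper _).2 (Nat.dvd_add h2 h1), mul_zero]

theorem aeval_derivative_aPoly_succ (i : ℕ) :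
    aeval c (derivative (aPoly d (i + 1))) =
      d * aSeq d c i ^ (d - 1) * aeval c (derivative (aPoly d i)) + 1 := by
  simp [aPoly, derivative_pow, aSeq_eq_aeval_aPoly]

theorem exists_aeval_derivative_aPoly_eq {i : ℕ} (hi : 0 < i) :
    ∃ y, aeval c (derivative (aPoly d i)) = 1 + d * y := by
  obtain ⟨i, rfl⟩ := Nat.exists_eq_succ_of_ne_zero hi.ne'
  exact ⟨_, by rw [Nat.succ_eq_add_one, aeval_derivative_aPoly_succ, add_comm, mul_assoc]⟩

theorem aeval_derivative_aPoly_sub_ne_zero [IsDomain A] (hd : d.Prime)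
    (hunit : ∀ z : A, 1 + d * z ≠ 0) {ζ : A} (hζ : ζ ^ d = 1) (hζ1 : ζ ≠ 1) {m k : ℕ} (hm : 0 < m)
    (hk : aSeq d c k = 0) :
    aeval c (derivative (aPoly d (k + m))) - ζ * aeval c (derivative (aPoly d m)) ≠ 0 := by
  obtain ⟨i, rfl⟩ := Nat.exists_eq_succ_of_ne_zero hm.ne'
  obtain ⟨w, hw⟩ := one_sub_dvd_natCast_of_pow_eq_one hζ hζ1
  have hsucc : k + (i + 1) = k + i + 1 := rfl
  rw [Nat.succ_eq_add_one, hsucc, aeval_derivative_aPoly_succ, aeval_derivative_aPoly_succ,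
    aSeq_add_eq_of_eq_zero hd hk]
  suffices ∃ z, d * aSeq d c i ^ (d - 1) * (aeval c (derivative (aPoly d (k + i))) -
      ζ * aeval c (derivative (aPoly d i))) = (1 - ζ) * (d * z) by
    obtain ⟨z, hz⟩ := this
    have heq := mul_ne_zero (sub_ne_zero.2 hζ1.symm) (hunit z)
    convert heq using 1
    linear_combination hz
  rcases Nat.eq_zero_or_pos i with rfl | hi
  · exact ⟨0, by simp [aSeq, Nat.sub_ne_zero_of_lt hd.one_lt]⟩
  · obtain ⟨y, hy⟩ := exists_aeval_derivative_aPoly_eq (d := d) (c := c) (i := k + i) (by omega)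
    obtain ⟨y', hy'⟩ := exists_aeval_derivative_aPoly_eq (d := d) (c := c) hi
    refine ⟨aSeq d c i ^ (d - 1) * (1 + w * (y - ζ * y')), ?_⟩
    rw [hy, hy']
    linear_combination (d * aSeq d c i ^ (d - 1) * (y - ζ * y')) * hw

end Periodic

section Integrality

theorem aPoly_succ_monic_natDegree {d : ℕ} (hd : 1 < d) (i : ℕ) :
    (aPoly d (i + 1)).Monic ∧ (aPoly d (i + 1)).natDegree = d ^ i := by
  induction i with
  | zero => simp [aPoly, show d ≠ 0 by omega, monic_X]
  | succ i ih =>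
    have h : (aPoly d (i + 1) ^ d).natDegree = d ^ (i + 1) := by
      rw [ih.1.natDegree_pow, ih.2, pow_succ, mul_comm]
    have hlt : (X : ℤ[X]).degree < (aPoly d (i + 1) ^ d).degree := by
      rw [degree_eq_natDegree (ih.1.pow d).ne_zero, h, degree_X]
      exact_mod_cast Nat.one_lt_pow (by omega) hd
    exact ⟨(ih.1.pow d).add_of_left hlt, by
      rw [aPoly, natDegree_add_eq_left_of_degree_lt hlt, h]⟩

theorem isIntegral_of_aSeq_eq {A : Type*} [CommRing A] {d : ℕ} (hd : 1 < d) {c : A} {i j : ℕ}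
    (hij : i < j) (h : aSeq d c j = aSeq d c i) : IsIntegral ℤ c := by
  obtain ⟨j, rfl⟩ := Nat.exists_eq_succ_of_ne_zero (Nat.ne_zero_of_lt hij)
  obtain ⟨hj1, hj2⟩ := aPoly_succ_monic_natDegree hd j
  refine ⟨aPoly d (j + 1) - aPoly d i, hj1.sub_of_left ?_, ?_⟩
  · rcases Nat.eq_zero_or_pos i with rfl | hi
    · rw [aPoly, degree_zero, bot_lt_iff_ne_bot, Ne, degree_eq_bot]
      exact hj1.ne_zero
    · obtain ⟨i, rfl⟩ := Nat.exists_eq_succ_of_ne_zero hi.ne'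
      obtain ⟨hi1, hi2⟩ := aPoly_succ_monic_natDegree hd i
      rw [degree_eq_natDegree hj1.ne_zero, degree_eq_natDegree hi1.ne_zero, hj2, hi2]
      exact_mod_cast Nat.pow_lt_pow_right hd (by omega)
  · rw [← aeval_def, map_sub, ← aSeq_eq_aeval_aPoly, ← aSeq_eq_aeval_aPoly, sub_eq_zero]
    exact h

theorem one_add_natCast_mul_ne_zero_of_isIntegral {F : Type*} [Field F] [CharZero F] {d : ℕ}
    (hd : d.Prime) {z : F} (hz : IsIntegral ℤ z) : 1 + d * z ≠ 0 := by
  intro h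
  have hd0 : (d : F) ≠ 0 := by exact_mod_cast hd.ne_zero
  have hz' : algebraMap ℚ F (-(1 / d)) = z := by
    simp only [one_div, map_neg, map_inv₀, map_natCast]
    field_simp
    linear_combination -h
  rw [← hz', isIntegral_algebraMap_iff (algebraMap ℚ F).injective] at hz
  obtain ⟨y, hy⟩ := IsIntegrallyClosed.isIntegral_iff.1 hz
  have hdQ : (d : ℚ) ≠ 0 := by exact_mod_cast hd.ne_zero
  have hy' : (d : ℤ) * (-y) = 1 := by
    have : (d : ℚ) * (-y) = 1 := by
      rw [eq_intCast] at hy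
      rw [hy]
      field_simp
    exact_mod_cast this
  have := Int.isUnit_iff.1 (IsUnit.of_mul_eq_one _ hy')
  have := hd.two_le
  omega

end Integrality

section MisiurewiczRoot

theorem emultiplicity_X_sub_C_of_derivative_ne_zero {F : Type*} [Field F] {f : F[X]} {a : F}
    (h : f.eval a = 0 → (derivative f).eval a ≠ 0) [Decidable (f.eval a = 0)] :
    emultiplicity (X - C a) f = ((if f.eval a = 0 then 1 else 0 : ℕ) : ℕ∞) := by
  split_ifs with hf
  · rw [emultiplicity_eq_coe]
    refine ⟨by rwa [pow_one, dvd_iff_isRoot], fun ⟨q, hq⟩ ↦ h hf ?_⟩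
    rw [hq]
    simp [derivative_pow]
  · rw [Nat.cast_zero, emultiplicity_eq_zero, dvd_iff_isRoot]
    exact hf

theorem sum_divisors_toNat_moebius_eq {n p : ℕ} (hn : 0 < n) (hnp : n ≠ p) :
    ∑ k ∈ n.divisors, (ArithmeticFunction.moebius (n / k)).toNat * (if p ∣ k then 1 else 0) =
    ∑ k ∈ n.divisors, (-(ArithmeticFunction.moebius (n / k))).toNat *
      (if p ∣ k then 1 else 0) := by
  have h := (ArithmeticFunction.sum_eq_iff_sum_mul_moebius_eq (R := ℤ)
    (f := fun i ↦ if i = p then 1 else 0) (g := fun k ↦ if p ∣ k then 1 else 0)).1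
    (fun k hk ↦ by simp [Finset.sum_ite_eq', Nat.mem_divisors, hk.ne']) n hn
  simp only [Int.cast_id] at h
  rw [if_neg hnp, Nat.sum_divisorsAntidiagonal'
    (f := fun x y ↦ ArithmeticFunction.moebius x * if p ∣ y then 1 else 0)] at h
  apply Nat.cast_injective (R := ℤ)
  push_cast
  refine sub_eq_zero.1 (Eq.trans ?_ h)
  rw [← Finset.sum_sub_distrib]
  refine Finset.sum_congr rfl fun k _ ↦ ?_
  rw [← sub_mul, Int.toNat_sub_toNat_neg]

theorem eval_map_intCast {c : ℂ} (f : ℤ[X]) :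
    (f.map (Int.castRingHom ℂ)).eval c = aeval c f := by
  rw [eval_map, aeval_def]
  rfl

theorem isMisiurewiczRoot.aSeq_ne_zero {d m n : ℕ} {ζ c₀ : ℂ} (hd : d.Prime) (hζ1 : ζ ≠ 1)
    (hζd : ζ ^ d = 1) (hm : 2 ≤ m) (hn : 1 ≤ n) (hc₀ : isMisiurewiczRoot d m n ζ c₀) {j : ℕ}
    (hj : 0 < j) : aSeq d c₀ j ≠ 0 := by
  classical
  intro hj0
  have hint : IsIntegral ℤ c₀ := isIntegral_of_aSeq_eq hd.one_lt hj (by rw [hj0, aSeq])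
  obtain ⟨p, hp, hper⟩ := exists_pos_forall_mem_iff_dvd hd ⊥ c₀ hj (by simpa using hj0)
  simp only [Ideal.mem_bot] at hper
  obtain ⟨m, rfl⟩ : ∃ m', m = m' + 1 := ⟨m - 1, by omega⟩
  have hm0 : 0 < m := by omega
  obtain ⟨g, hg, hg0⟩ := hc₀
  simp only [Nat.add_sub_cancel] at hg
  set E := emultiplicity (X - C c₀) with hE
  have hpr := prime_X_sub_C c₀
  let c : integralClosure ℤ ℂ := ⟨c₀, hint⟩
  let z : integralClosure ℤ ℂ := ⟨ζ, IsIntegral.of_pow hd.pos (hζd ▸ isIntegral_one)⟩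
  have hzd : z ^ d = 1 := Subtype.ext hζd
  have hz1 : z ≠ 1 := fun h ↦ hζ1 (congrArg Subtype.val h)
  have hunit : ∀ x : integralClosure ℤ ℂ, 1 + d * x ≠ 0 := fun x h ↦
    one_add_natCast_mul_ne_zero_of_isIntegral hd x.2 (by simpa using congrArg Subtype.val h)
  have hcoe : ∀ f : ℤ[X], ((aeval c f : integralClosure ℤ ℂ) : ℂ) = aeval c₀ f := fun f ↦
    (aeval_algHom_apply (integralClosure ℤ ℂ).val c f).symm
  have hcseq : ∀ k, aSeq d c k = 0 ↔ p ∣ k := fun k ↦ by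
    rw [← hper, ← show ((aSeq d c k : integralClosure ℤ ℂ) : ℂ) = aSeq d c₀ k from
      aSeq_map (integralClosure ℤ ℂ).val.toRingHom k, ZeroMemClass.coe_eq_zero]
  have hEG : ∀ k ∈ n.divisors, E ((aPoly d k).map (Int.castRingHom ℂ)) =
      ((if p ∣ k then 1 else 0 : ℕ) : ℕ∞) := by
    intro k hk
    have heval : ((aPoly d k).map (Int.castRingHom ℂ)).eval c₀ = 0 ↔ p ∣ k := by
      rw [eval_map_intCast, ← aSeq_eq_aeval_aPoly, hper]
    rw [hE, emultiplicity_X_sub_C_of_derivative_ne_zero, if_congr heval rfl rfl]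
    intro _
    obtain ⟨y, hy⟩ := exists_aeval_derivative_aPoly_eq (d := d) (c := c)
      (Nat.pos_of_mem_divisors hk)
    rw [derivative_map, eval_map_intCast, ← hcoe, hy]
    exact fun h ↦ hunit y (Subtype.ext h)
  have hEF : ∀ k ∈ n.divisors, E ((aPoly d (m + 1 + k - 1)).map (Int.castRingHom ℂ) -
      C ζ * (aPoly d m).map (Int.castRingHom ℂ)) =
      ((if p ∣ m ∧ p ∣ k then 1 else 0 : ℕ) : ℕ∞) := by
    intro k hk
    rw [show m + 1 + k - 1 = k + m by omega]
    have heval : ((aPoly d (k + m)).map (Int.castRingHom ℂ) -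
        C ζ * (aPoly d m).map (Int.castRingHom ℂ)).eval c₀ = 0 ↔ p ∣ m ∧ p ∣ k := by
      rw [eval_sub, eval_mul, eval_C, eval_map_intCast, eval_map_intCast, ← aSeq_eq_aeval_aPoly,
        ← aSeq_eq_aeval_aPoly, sub_eq_zero, aSeq_add_eq_mul_iff hd hζd hζ1 hp hper]
    rw [hE, emultiplicity_X_sub_C_of_derivative_ne_zero, if_congr heval rfl rfl]
    intro h
    have := aeval_derivative_aPoly_sub_ne_zero hd hunit hzd hz1 hm0
      ((hcseq k).2 (heval.1 h).2)
    rw [derivative_sub, derivative_C_mul, eval_sub, eval_mul, eval_C, derivative_map,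
      derivative_map, eval_map_intCast, eval_map_intCast, ← hcoe, ← hcoe]
    exact fun h ↦ this (Subtype.ext h)
  have hprod : ∀ (F : ℕ → ℂ[X]) (e μ : ℕ → ℕ), (∀ k ∈ n.divisors, E (F k) = (e k : ℕ∞)) →
      E (∏ k ∈ n.divisors, F k ^ μ k) = ((∑ k ∈ n.divisors, μ k * e k : ℕ) : ℕ∞) := by
    intro F e μ h
    rw [hE, Finset.emultiplicity_prod hpr, Nat.cast_sum]
    refine Finset.sum_congr rfl fun k hk ↦ ?_
    rw [emultiplicity_pow hpr, ← hE, h k hk, Nat.cast_mul]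
  have hEg : E g ≠ 0 := by
    rw [hE, Ne, emultiplicity_eq_zero, dvd_iff_isRoot, not_not]
    exact hg0
  have hcancel : ∀ a b : ℕ, a = b → E g + a = b → False := by
    rintro a _ rfl h
    exact hEg ((ENat.add_left_injective_of_ne_top (ENat.natCast_ne_top a)) (by simpa using h))
  have hEhg := congrArg E hg
  have hsum := fun h : n ≠ p ↦ sum_divisors_toNat_moebius_eq hn h
  have hE1 : E 1 = ((0 : ℕ) : ℕ∞) := by
    rw [hE, Nat.cast_zero, emultiplicity_eq_zero, ← isUnit_iff_dvd_one]
    exact hpr.not_isUnit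
  rw [hE, emultiplicity_mul hpr, emultiplicity_mul hpr, emultiplicity_mul hpr, ← hE,
    hprod _ _ _ hEF, hprod _ _ _ hEF] at hEhg
  by_cases hnm : n ∣ m
  · rw [if_pos hnm, if_pos hnm, hprod _ _ _ hEG, hprod _ _ _ hEG, ← Nat.cast_add,
      ← Nat.cast_add] at hEhg
    refine hcancel _ _ ?_ hEhg
    by_cases hpm : p ∣ m
    · simp only [hpm, true_and]
      exact add_comm _ _
    · simp only [hpm, false_and, if_false, mul_zero, Finset.sum_const_zero, zero_add]
      exact hsum fun h ↦ hpm (h ▸ hnm)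
  · rw [if_neg hnm, if_neg hnm, hE1, ← Nat.cast_add, ← Nat.cast_add] at hEhg
    refine hcancel _ _ ?_ hEhg
    by_cases hpm : p ∣ m
    · simp only [hpm, true_and, add_zero]
      exact (hsum fun h ↦ hnm (h ▸ hpm)).symm
    · simp [hpm]

theorem isMisiurewiczRoot.exists_aSeq_eq {d m n : ℕ} {ζ c₀ : ℂ} (hm : 2 ≤ m)
    (hne : ∀ j, 0 < j → aSeq d c₀ j ≠ 0) (hc₀ : isMisiurewiczRoot d m n ζ c₀) :
    ∃ N, 0 < N ∧ aSeq d c₀ (N + (m - 1)) = ζ * aSeq d c₀ (m - 1) := by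
  obtain ⟨g, hg, hg0⟩ := hc₀
  replace hg := congrArg (eval c₀) hg
  rw [eval_mul, hg0, zero_mul, eval_mul, eq_comm, mul_eq_zero] at hg
  rcases hg with hg | hg
  · rw [eval_prod, Finset.prod_eq_zero_iff] at hg
    obtain ⟨k, hk, hk0⟩ := hg
    rw [eval_pow] at hk0
    replace hk0 := eq_zero_of_pow_eq_zero hk0
    rw [eval_sub, eval_mul, eval_C, eval_map_intCast, eval_map_intCast, ← aSeq_eq_aeval_aPoly,
      ← aSeq_eq_aeval_aPoly, sub_eq_zero] at hk0
    exact ⟨k, Nat.pos_of_mem_divisors hk, by rwa [show k + (m - 1) = m + k - 1 by omega]⟩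
  · exfalso
    split_ifs at hg
    · rw [eval_prod, Finset.prod_eq_zero_iff] at hg
      obtain ⟨k, hk, hk0⟩ := hg
      rw [eval_pow] at hk0
      replace hk0 := eq_zero_of_pow_eq_zero hk0
      rw [eval_map_intCast, ← aSeq_eq_aeval_aPoly] at hk0
      exact hne k (Nat.pos_of_mem_divisors hk) hk0
    · simp at hg

end MisiurewiczRoot

section NumberField

open WithZero

theorem exists_valuation_aSeq_eq {K : Type*} [Field K]
    (v : Valuation K (WithZero (Multiplicative ℤ))) (hv : ∀ x : K, IsIntegral ℤ x → v x ≤ 1)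
    (hunif : ∃ x, v x = exp (-1 : ℤ)) {d : ℕ} (hd : d.Prime) (hdv : v d < 1) {c ζ : K}
    (hc : IsIntegral ℤ c) (hζ : ζ ^ d = 1) (hζ1 : ζ ≠ 1)
    (hfrac : ∀ x : K, ∃ (b : ℤ) (h : ℤ[X]), (b : K) ≠ 0 ∧ x * b = aeval c h)
    {m N : ℕ} (hm : 0 < m) (hN : 0 < N) (hrel : aSeq d c (N + m) = ζ * aSeq d c m)
    (hne : ∀ j, 0 < j → aSeq d c j ≠ 0) :
    ∃ p, 0 < p ∧ v (aSeq d c p) = exp (-1 : ℤ) := by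
  let A := Algebra.adjoin ℤ {c, ζ}
  have hζint : IsIntegral ℤ ζ := IsIntegral.of_pow hd.pos (hζ ▸ isIntegral_one)
  have hA : ∀ a : A, v a ≤ 1 := by
    have hle : A ≤ integralClosure ℤ K := Algebra.adjoin_le (by
      rintro x (rfl | rfl)
      · exact hc
      · exact hζint)
    exact fun a ↦ hv a (hle a.2)
  let c' : A := ⟨c, Algebra.subset_adjoin (by simp)⟩
  let ζ' : A := ⟨ζ, Algebra.subset_adjoin (by simp)⟩
  have hseq : ∀ i, ((aSeq d c' i : A) : K) = aSeq d c i := fun i ↦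
    aSeq_map A.val.toRingHom i
  have hcoe : ∀ f : ℤ[X], ((aeval c' f : A) : K) = aeval c f := fun f ↦
    (aeval_algHom_apply A.val c' f).symm
  let I : Ideal A :=
    { carrier := {x | v x < 1}
      add_mem' := fun {a b} ha hb ↦ by
        simpa using v.map_add_lt ha hb
      zero_mem' := by simp
      smul_mem' := fun a b hb ↦ by
        simpa using (mul_le_of_le_one_left' (hA a)).trans_lt hb }
  have hI : ∀ x : A, x ∈ I ↔ v x < 1 := fun _ ↦ Iff.rfl
  have hnI : ∀ x : A, x ∉ I ↔ v x = 1 := fun x ↦ by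
    rw [hI, not_lt]
    exact ⟨fun h ↦ le_antisymm (hA x) h, fun h ↦ h.ge⟩
  have : I.IsPrime := by
    refine ⟨(Ideal.ne_top_iff_one I).2 (by simp [hI]), fun {x y} hxy ↦ ?_⟩
    by_contra! h
    rw [hnI, hnI] at h
    rw [hI] at hxy
    simp [h.1, h.2] at hxy
  have hgen : ∀ x : A, ∃ (h : ℤ[X]) (y : A), x = aeval c' h + (1 - ζ') * y := by
    rintro ⟨x, hx⟩
    suffices ∃ (h : ℤ[X]) (y : A), x = aeval c h + (1 - ζ) * y by
      obtain ⟨h, y, hy⟩ := this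
      exact ⟨h, y, Subtype.ext (by push_cast [hcoe]; exact hy)⟩
    induction hx using Algebra.adjoin_induction with
    | mem x hx =>
      rcases hx with rfl | rfl
      · exact ⟨X, 0, by simp⟩
      · exact ⟨1, -1, by simp⟩
    | algebraMap r => exact ⟨C r, 0, by simp⟩
    | add x y _ _ hx hy =>
      obtain ⟨h, a, rfl⟩ := hx
      obtain ⟨h', a', rfl⟩ := hy
      exact ⟨h + h', a + a', by push_cast [map_add]; ring⟩
    | mul x y _ _ hx hy =>
      obtain ⟨h, a, rfl⟩ := hx
      obtain ⟨h', a', rfl⟩ := hy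
      exact ⟨h * h', aeval c' h * a' + aeval c' h' * a + (1 - ζ') * a * a', by
        push_cast [map_mul, hcoe]; ring⟩
  obtain ⟨p, hp, hpI, hstep⟩ := exists_notMem_aSeq_dvd_mul hd
    (show ζ' ^ d = 1 from Subtype.ext hζ) (fun h ↦ hζ1 (congrArg Subtype.val h)) hgen
    (I := I) (by simpa [hI] using hdv) hm hN
    (Subtype.ext (by push_cast [hseq]; exact hrel))
    (fun j hj h ↦ hne j hj (by rw [← hseq, h]; rfl))
  refine ⟨p, hp, ?_⟩
  rw [← hseq]
  refine valuation_eq_exp_neg_one_of_generates (A := A) v hA (fun x ↦ ?_) ?_ hpI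
    (fun x hx ↦ ?_) hunif
  · obtain ⟨b, h, hb, hx⟩ := hfrac x
    exact ⟨aeval c' h, b, by simpa using hb, by
      rw [show algebraMap A K (aeval c' h) = aeval c h from hcoe h, ← hx]; simp⟩
  · exact (hseq p).trans_ne (hne p hp)
  · obtain ⟨s, hs, hdvd⟩ := hstep x hx
    exact ⟨s, (hnI s).1 hs, hdvd⟩

theorem exists_mul_intCast_eq_aeval_gen {L : Type*} [Field L] [CharZero L] {c : L}
    (hc : IsIntegral ℤ c) (x : ℚ⟮c⟯) :
    ∃ (b : ℤ) (h : ℤ[X]), (b : ℚ⟮c⟯) ≠ 0 ∧ x * b = aeval (AdjoinSimple.gen ℚ c) h := by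
  have hcQ : IsIntegral ℚ c := hc.tower_top
  obtain ⟨f, hf⟩ := (IntermediateField.adjoin.powerBasis hcQ).exists_eq_aeval' x
  rw [IntermediateField.adjoin.powerBasis_gen] at hf
  obtain ⟨b, hb, hbf⟩ := IsLocalization.integerNormalization_spec (nonZeroDivisors ℤ) f
  refine ⟨b, IsLocalization.integerNormalization (nonZeroDivisors ℤ) f,
    by exact_mod_cast nonZeroDivisors.ne_zero hb, ?_⟩
  rw [← aeval_map_algebraMap ℚ, hbf, map_zsmul, hf, zsmul_eq_mul]
  exact mul_comm _ _

end NumberField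

/-- If `c₀` is a Misiurewicz parameter (root of `G_{d,m,n}^ζ`), `K = ℚ(c₀)`,
and `α ∈ K` has `v_𝔭(α) ≥ 2` at some prime `𝔭` of `O_K` above `d`, then `(f_{d,c₀}, α)` is
stable over `K`: every iterate minus `α` is irreducible. -/
theorem stmt0 (d : ℕ) (hd : Nat.Prime d) (ζ : ℂ) (hζ1 : ζ ≠ 1) (hζd : ζ ^ d = 1)
    (m n : ℕ) (hm : 2 ≤ m) (hn : 1 ≤ n)
    (c₀ : ℂ) (hc₀ : isMisiurewiczRoot d m n ζ c₀)
    (α : ℚ⟮c₀⟯)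
    (𝔭 : Ideal (integralClosure ℤ ℚ⟮c₀⟯)) (h𝔭 : 𝔭.IsPrime)
    (h𝔭d : (d : integralClosure ℤ ℚ⟮c₀⟯) ∈ 𝔭)
    (hα : ∃ a b : integralClosure ℤ ℚ⟮c₀⟯, b ∉ 𝔭 ∧ α * b = a ∧ a ∈ 𝔭 ^ 2) :
    ∀ k : ℕ, 1 ≤ k →
      Irreducible (fIter d (IntermediateField.AdjoinSimple.gen ℚ c₀) k - C α) := by
  intro k _
  have hne₀ : ∀ j, 0 < j → aSeq d c₀ j ≠ 0 := fun j hj ↦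
    hc₀.aSeq_ne_zero hd hζ1 hζd hm hn hj
  obtain ⟨N, hN, hrel₀⟩ := hc₀.exists_aSeq_eq hm hne₀
  have hm1 : 0 < m - 1 := by omega
  have hint₀ : IsIntegral ℤ c₀ := by
    refine isIntegral_of_aSeq_eq hd.one_lt (i := m - 1 + 1) (j := N + (m - 1) + 1) (by omega) ?_
    simp [aSeq, hrel₀, mul_pow, hζd]
  have : FiniteDimensional ℚ ℚ⟮c₀⟯ := adjoin.finiteDimensional hint₀.tower_top
  set c := AdjoinSimple.gen ℚ c₀
  have hseq : ∀ i, ((aSeq d c i : ℚ⟮c₀⟯) : ℂ) = aSeq d c₀ i := fun i ↦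
    aSeq_map (algebraMap ℚ⟮c₀⟯ ℂ) i
  have hne : ∀ j, 0 < j → aSeq d c j ≠ 0 := fun j hj h ↦
    hne₀ j hj (by rw [← hseq, h]; rfl)
  have hint : IsIntegral ℤ c :=
    (isIntegral_algebraMap_iff (algebraMap ℚ⟮c₀⟯ ℂ).injective).1 hint₀
  obtain ⟨z, hz⟩ : ∃ z : ℚ⟮c₀⟯, (z : ℂ) = ζ := by
    refine ⟨aSeq d c (N + (m - 1)) / aSeq d c (m - 1), ?_⟩
    push_cast [hseq]
    rw [hrel₀, mul_div_cancel_right₀ _ (hne₀ _ hm1)]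
  have hrel : aSeq d c (N + (m - 1)) = z * aSeq d c (m - 1) :=
    Subtype.ext (by push_cast [hseq]; rw [hrel₀, hz])
  have hzd : z ^ d = 1 := Subtype.ext (by push_cast; rw [hz, hζd])
  have hz1 : z ≠ 1 := fun h ↦ hζ1 (by rw [← hz, h]; rfl)
  have : IsDedekindDomain (integralClosure ℤ ℚ⟮c₀⟯) := integralClosure.isDedekindDomain ℤ ℚ _
  have : IsFractionRing (integralClosure ℤ ℚ⟮c₀⟯) ℚ⟮c₀⟯ :=
    integralClosure.isFractionRing_of_finite_extension ℚ _
  let P : IsDedekindDomain.HeightOneSpectrum (integralClosure ℤ ℚ⟮c₀⟯) :=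
    ⟨𝔭, h𝔭, fun h ↦ by
      rw [h, Ideal.mem_bot] at h𝔭d
      exact hd.ne_zero (by exact_mod_cast h𝔭d)⟩
  let v := P.valuation ℚ⟮c₀⟯
  have hv : ∀ x : ℚ⟮c₀⟯, IsIntegral ℤ x → v x ≤ 1 := fun x hx ↦ P.valuation_le_one ⟨x, hx⟩
  have hdv : v d < 1 := by
    have := (P.valuation_lt_one_iff_mem (K := ℚ⟮c₀⟯) (d : integralClosure ℤ ℚ⟮c₀⟯)).2 h𝔭d
    simpa using this
  obtain ⟨p, hp, hpv⟩ := exists_valuation_aSeq_eq v hv (P.valuation_exists_uniformizer _) hd hdv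
    hint hzd hz1 (exists_mul_intCast_eq_aeval_gen hint₀) hm1 hN hrel hne
  refine irreducible_fIter_sub_C_of_valuation v hd hdv (hv c hint) ?_ hp hpv k
  obtain ⟨a, b, hb, hab, ha⟩ := hα
  have hvb : v b = 1 := (P.valuation_eq_one_iff_notMem (K := ℚ⟮c₀⟯)).2 hb
  have hva : v a ≤ WithZero.exp (-2 : ℤ) := by
    have := (P.intValuation_le_pow_iff_mem a 2).2 ha
    rwa [← P.valuation_of_algebraMap (K := ℚ⟮c₀⟯)] at this
  rwa [← hab, map_mul, hvb, mul_one] at hva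
end
end

section
/- Let d be a prime and let c_0 ∈ ℂ be a root of the Gleason polynomial G_{d,n} for some n ≥ 2. Set K = ℚ(c_0). Then for every k ≥ 1, the polynomial f_{d,c_0}^k has exactly k − ⌊k/n⌋ + 1 distinct irreducible factors over K (counted without multiplicity). -/
open Polynomial IntermediateField

noncomputable section

section Orbit

variable {R : Type*} [CommRing R] {d : ℕ} {c : R}

lemma aSeq_add_of_eq_zero {n : ℕ} (h : aSeq d c n = 0) (i : ℕ) :
    aSeq d c (i + n) = aSeq d c i := by
  induction i with
  | zero => simpa [aSeq] using h
  | succ i ih => rw [Nat.add_right_comm, aSeq, aSeq, ih]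

lemma aSeq_add_mul_of_eq_zero {n : ℕ} (h : aSeq d c n = 0) (i m : ℕ) :
    aSeq d c (i + n * m) = aSeq d c i := by
  induction m with
  | zero => rfl
  | succ m ih => rw [Nat.mul_succ, ← Nat.add_assoc, aSeq_add_of_eq_zero h, ih]

lemma aSeq_mod_of_eq_zero {n : ℕ} (h : aSeq d c n = 0) (i : ℕ) :
    aSeq d c (i % n) = aSeq d c i := by
  conv_rhs => rw [← Nat.mod_add_div i n]
  rw [aSeq_add_mul_of_eq_zero h]

lemma aSeq_eq_zero_of_dvd {n i : ℕ} (h : aSeq d c n = 0) (hi : n ∣ i) : aSeq d c i = 0 := by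
  rw [← aSeq_mod_of_eq_zero h, Nat.mod_eq_zero_of_dvd hi, aSeq]

lemma map_aSeq {S : Type*} [CommRing S] (φ : R →+* S) (i : ℕ) :
    φ (aSeq d c i) = aSeq d (φ c) i := by
  induction i with
  | zero => simp [aSeq]
  | succ i ih => simp [aSeq, ih]

lemma aSeq_pow_dvd_sub (j i : ℕ) :
    aSeq d c j ^ d ∣ aSeq d c (j + (i + 1)) - aSeq d c (i + 1) := by
  induction i with
  | zero =>
    rcases Nat.eq_zero_or_pos d with rfl | hd
    · simp
    · simp [aSeq, hd.ne']
  | succ i ih =>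
    rw [← Nat.add_assoc j, aSeq, aSeq, add_sub_add_right_eq_sub]
    exact ih.trans (sub_dvd_pow_sub_pow _ _ d)

lemma aSeq_dvd_mul (hd : d ≠ 0) (i m : ℕ) : aSeq d c i ∣ aSeq d c (i * m) := by
  rcases i with _ | i
  · simp
  induction m with
  | zero => simp [aSeq]
  | succ m ih =>
    have h := (ih.trans (dvd_pow_self _ hd)).trans (aSeq_pow_dvd_sub (d := d) (c := c) ((i + 1) * m) i)
    rw [Nat.mul_succ]
    exact (dvd_sub_left dvd_rfl).1 h

lemma isUnit_aSeq_of_dvd [IsDomain R] (hd : 2 ≤ d) {n g : ℕ} (hn : aSeq d c n = 0) (hgn : g ∣ n)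
    (hg : aSeq d c g ≠ 0) (hn0 : n ≠ 0) : IsUnit (aSeq d c g) := by
  obtain ⟨m, rfl⟩ := hgn
  rcases g with _ | g
  · simp at hn0
  rcases m with _ | m
  · simp at hn0
  have h1 : aSeq d c (g + 1) ^ d ∣ aSeq d c ((g + 1) * m) ^ d :=
    pow_dvd_pow_of_dvd (aSeq_dvd_mul (by omega) _ _) _
  have h2 := h1.trans (aSeq_pow_dvd_sub (d := d) (c := c) ((g + 1) * m) g)
  rw [← Nat.mul_succ, hn, zero_sub, dvd_neg] at h2
  have h3 := (pow_dvd_pow (aSeq d c (g + 1)) hd).trans h2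
  rw [sq] at h3
  exact isUnit_of_dvd_one ((mul_dvd_mul_iff_left hg).1 (by simpa using h3))

lemma isUnit_aSeq [IsDomain R] (hd : 2 ≤ d) {n : ℕ} (hn0 : n ≠ 0) (hn : aSeq d c n = 0)
    (hne : ∀ i, ¬ n ∣ i → aSeq d c i ≠ 0) {i : ℕ} (hi : ¬ n ∣ i) : IsUnit (aSeq d c i) := by
  have hlt : Nat.gcd i n < n :=
    lt_of_le_of_ne (Nat.gcd_le_right _ (Nat.pos_of_ne_zero hn0)) fun h => hi (Nat.gcd_eq_right_iff_dvd.1 h)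
  have hg : ¬ n ∣ Nat.gcd i n := fun h => hi (h.trans (Nat.gcd_dvd_left _ _))
  obtain ⟨m, hm⟩ := Nat.exists_mul_mod_eq_gcd hlt
  have h := aSeq_dvd_mul (d := d) (c := c) (by omega) i m
  rw [← aSeq_mod_of_eq_zero hn (i * m), hm.2] at h
  exact isUnit_of_dvd_unit h (isUnit_aSeq_of_dvd hd hn (Nat.gcd_dvd_right _ _) (hne _ hg) hn0)

end Orbit

section Iterate

variable {R : Type*} [CommRing R] {d : ℕ} {c : R}

lemma map_fIter {S : Type*} [CommRing S] (φ : R →+* S) (k : ℕ) :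
    (fIter d c k).map φ = fIter d (φ c) k := by
  induction k with
  | zero => simp [fIter]
  | succ k ih => simp [fIter, ih]

lemma eval_fIter_aSeq (k j : ℕ) : (fIter d c k).eval (aSeq d c j) = aSeq d c (j + k) := by
  induction k with
  | zero => simp [fIter]
  | succ k ih => simp [fIter, ih, aSeq]

lemma monic_fIter_natDegree [Nontrivial R] (hd : d ≠ 0) (k : ℕ) :
    (fIter d c k).Monic ∧ (fIter d c k).natDegree = d ^ k := by
  induction k with
  | zero => simp [fIter]
  | succ k ih =>
    have hdeg : (fIter d c k ^ d).natDegree = d ^ (k + 1) := by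
      rw [ih.1.natDegree_pow, ih.2, pow_succ']
    have hlt : (C c : R[X]).degree < (fIter d c k ^ d).degree := by
      refine degree_C_le.trans_lt (natDegree_pos_iff_degree_pos.1 ?_)
      rw [hdeg]; positivity
    exact ⟨(ih.1.pow d).add_of_left hlt, by rw [fIter, natDegree_add_C, hdeg]⟩

lemma monic_fIter_sub_C [Nontrivial R] (hd : d ≠ 0) (k : ℕ) (a : R) :
    (fIter d c k - C a).Monic := by
  have h := monic_fIter_natDegree (c := c) hd k
  refine h.1.sub_of_left (degree_C_le.trans_lt (natDegree_pos_iff_degree_pos.1 ?_))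
  rw [h.2]; positivity

variable (d c) in
/-- The quotient of `f^{k+1} - a_{i+1}` by `f^k - a_i`, where `f = x^d + c`. -/
def cofactor (k i : ℕ) : R[X] :=
  ∑ j ∈ Finset.range d, fIter d c k ^ j * C (aSeq d c i) ^ (d - 1 - j)

lemma cofactor_mul (k i : ℕ) :
    cofactor d c k i * (fIter d c k - C (aSeq d c i)) =
      fIter d c (k + 1) - C (aSeq d c (i + 1)) := by
  rw [cofactor, geom_sum₂_mul, fIter, aSeq]
  simp

lemma monic_cofactor [Nontrivial R] (hd : d ≠ 0) (k i : ℕ) : (cofactor d c k i).Monic :=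
  (monic_fIter_sub_C hd k _).of_mul_monic_right (by
    rw [cofactor_mul]; exact monic_fIter_sub_C hd _ _)

lemma map_cofactor {S : Type*} [CommRing S] (φ : R →+* S) (k i : ℕ) :
    (cofactor d c k i).map φ = cofactor d (φ c) k i := by
  simp [cofactor, Polynomial.map_sum, map_fIter, map_aSeq φ]

lemma cofactor_of_aSeq_eq_zero {i : ℕ} (hd : d ≠ 0) (k : ℕ) (h : aSeq d c i = 0) :
    cofactor d c k i = fIter d c k ^ (d - 1) := by
  rw [cofactor, Finset.sum_eq_single (d - 1)]
  · simp
  · intro j hj hne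
    rw [h, C_0, zero_pow, mul_zero]
    have := Finset.mem_range.1 hj
    omega
  · intro hj
    simp at hj; omega

lemma fIter_sub_dvd_cofactor_sub (k i : ℕ) :
    fIter d c k - C (aSeq d c i) ∣ cofactor d c k i - C (d * aSeq d c i ^ (d - 1)) := by
  have h : C (d * aSeq d c i ^ (d - 1)) =
      ∑ j ∈ Finset.range d, C (aSeq d c i) ^ j * C (aSeq d c i) ^ (d - 1 - j) := by
    rw [Finset.sum_congr rfl (g := fun _ => C (aSeq d c i) ^ (d - 1))]
    · simp
    · intro j hj
      rw [← pow_add]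
      congr 1
      have := Finset.mem_range.1 hj
      omega
  rw [cofactor, h, ← Finset.sum_sub_distrib]
  refine Finset.dvd_sum fun j _ => ?_
  rw [← sub_mul]
  exact (sub_dvd_pow_sub_pow _ _ j).mul_right _

lemma eval_cofactor {k i j : ℕ} (h : aSeq d c (j + k) = aSeq d c i) :
    (cofactor d c k i).eval (aSeq d c j) = d * aSeq d c i ^ (d - 1) := by
  obtain ⟨q, hq⟩ := fIter_sub_dvd_cofactor_sub (d := d) (c := c) k i
  have := congrArg (eval (aSeq d c j)) hq
  simp only [eval_sub, eval_mul, eval_C, eval_fIter_aSeq, h, sub_self, zero_mul] at this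
  exact sub_eq_zero.1 this

lemma taylor_fIter_sub_of_charP [hp : Fact d.Prime] [CharP R d] (k j : ℕ) :
    taylor (aSeq d c j) (fIter d c k - C (aSeq d c (j + k))) = X ^ d ^ k := by
  induction k with
  | zero => simp [fIter]
  | succ k ih =>
    have h : fIter d c (k + 1) - C (aSeq d c (j + (k + 1))) =
        (fIter d c k - C (aSeq d c (j + k))) ^ d := by
      rw [sub_pow_char, fIter, ← Nat.add_assoc, aSeq]
      simp
    rw [h, taylor_pow, ih, ← pow_mul, pow_succ]

lemma taylor_cofactor_of_charP [IsDomain R] [hp : Fact d.Prime] [CharP R d] {k i j : ℕ}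
    (h : aSeq d c (j + k) = aSeq d c i) :
    taylor (aSeq d c j) (cofactor d c k i) = X ^ (d ^ k * (d - 1)) := by
  have h1 : taylor (aSeq d c j) (fIter d c k - C (aSeq d c i)) = X ^ d ^ k := by
    rw [← h, taylor_fIter_sub_of_charP]
  have h2 := congrArg (taylor (aSeq d c j)) (cofactor_mul (d := d) (c := c) k i)
  have h3 : aSeq d c (i + 1) = aSeq d c (j + (k + 1)) := by
    rw [← Nat.add_assoc, aSeq, aSeq, h]
  rw [taylor_mul, h1, h3, taylor_fIter_sub_of_charP] at h2
  refine mul_right_cancel₀ (pow_ne_zero (d ^ k) (X_ne_zero (R := R))) (h2.trans ?_)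
  rw [← pow_add, pow_succ]
  congr 1
  obtain ⟨e, rfl⟩ := Nat.exists_eq_succ_of_ne_zero hp.out.ne_zero
  simp [Nat.mul_succ]

end Iterate

section Eisenstein

variable {R : Type*} [CommRing R] [IsDomain R] {d : ℕ} {c : R}

lemma irreducible_cofactor (hp : d.Prime) {P : Ideal R} [hP : P.IsPrime] (hdP : (d : R) ∈ P)
    (hdP2 : (d : R) ∉ P ^ 2) {n : ℕ} (hn0 : n ≠ 0) (hn : aSeq d c n = 0)
    (hne : ∀ i, ¬ n ∣ i → aSeq d c i ≠ 0) (k : ℕ) {i : ℕ} (hi : ¬ n ∣ i) :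
    Irreducible (cofactor d c k i) := by
  have : Fact d.Prime := ⟨hp⟩
  have : CharP (R ⧸ P) d := ringChar.of_eq <| CharP.ringChar_of_prime_eq_zero hp <| by
    rw [← map_natCast (Ideal.Quotient.mk P), Ideal.Quotient.eq_zero_iff_mem]
    exact hdP
  obtain ⟨j, hj⟩ : ∃ j, aSeq d c (j + k) = aSeq d c i := by
    refine ⟨i + k * (n - 1), ?_⟩
    obtain ⟨m, rfl⟩ := Nat.exists_eq_succ_of_ne_zero hn0
    rw [← aSeq_add_mul_of_eq_zero hn i k]
    congr 1
    simp; ring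
  have hmap : (taylor (aSeq d c j) (cofactor d c k i)).map (Ideal.Quotient.mk P) =
      X ^ (d ^ k * (d - 1)) := by
    rw [map_taylor, map_cofactor, map_aSeq]
    apply taylor_cofactor_of_charP
    rw [← map_aSeq, ← map_aSeq, hj]
  have hmonic : (taylor (aSeq d c j) (cofactor d c k i)).Monic := by
    rw [Monic, leadingCoeff_taylor]
    exact monic_cofactor hp.ne_zero k i
  have hdeg : (taylor (aSeq d c j) (cofactor d c k i)).natDegree = d ^ k * (d - 1) := by
    rw [← hmonic.natDegree_map (Ideal.Quotient.mk P), hmap, natDegree_X_pow]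
  have hE : (taylor (aSeq d c j) (cofactor d c k i)).IsEisensteinAt P := by
    refine ⟨?_, ?_, ?_⟩
    · rw [hmonic.leadingCoeff]
      exact fun h => hP.ne_top ((Ideal.eq_top_iff_one P).2 h)
    · intro m hm
      rw [← Ideal.Quotient.eq_zero_iff_mem, ← coeff_map, hmap, coeff_X_pow, if_neg]
      omega
    · rw [taylor_coeff_zero, eval_cofactor hj]
      intro h
      exact hdP2 ((Ideal.mul_unit_mem_iff_mem _
        ((isUnit_aSeq hp.two_le hn0 hn hne hi).pow (d - 1))).1 h)
  have hirr := hE.irreducible hP hmonic.isPrimitive (by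
    rw [hdeg]
    exact Nat.mul_pos (pow_pos hp.pos k) (Nat.sub_pos_of_lt hp.one_lt))
  exact (MulEquiv.irreducible_iff (taylorEquiv (aSeq d c j))).1 hirr

end Eisenstein
section Count

variable {F : Type*} [Field F] {d n : ℕ} {c : F}

lemma cofactor_not_dvd {k i : ℕ} (hirr : Irreducible (cofactor d c k i)) (hd : (d : F) ≠ 0)
    (hi : aSeq d c i ≠ 0) : ¬ cofactor d c k i ∣ fIter d c k - C (aSeq d c i) := by
  intro h
  have h1 := h.trans (fIter_sub_dvd_cofactor_sub (d := d) (c := c) k i)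
  have h2 := (dvd_sub_right dvd_rfl).1 h1
  exact hirr.not_isUnit (isUnit_of_dvd_unit h2
    (isUnit_C.2 (mul_ne_zero hd (pow_ne_zero _ hi)).isUnit))

lemma finite_setOf_monic_irreducible_dvd {p : F[X]} (hp : p ≠ 0) :
    {q : F[X] | q.Monic ∧ Irreducible q ∧ q ∣ p}.Finite := by
  classical
  refine (UniqueFactorizationMonoid.normalizedFactors p).toFinset.finite_toSet.subset ?_
  rintro q ⟨h1, h2, h3⟩
  rw [Finset.mem_coe, Multiset.mem_toFinset, UniqueFactorizationMonoid.mem_normalizedFactors_iff' hp]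
  exact ⟨h2, h1.normalize_eq_self, h3⟩

lemma ncard_factors_add (hd : d.Prime) (hdF : (d : F) ≠ 0) (hn0 : n ≠ 0) (hn : aSeq d c n = 0)
    (hne : ∀ i, ¬ n ∣ i → aSeq d c i ≠ 0)
    (hirr : ∀ k i, ¬ n ∣ i → Irreducible (cofactor d c k i)) (j k : ℕ) :
    {p : F[X] | p.Monic ∧ Irreducible p ∧ p ∣ fIter d c k - C (aSeq d c (j + k))}.ncard +
      (j + k + (n - 1)) / n = 1 + k + (j + (n - 1)) / n := by
  induction k with
  | zero =>
    have h : {p : F[X] | p.Monic ∧ Irreducible p ∧ p ∣ fIter d c 0 - C (aSeq d c (j + 0))} =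
        {X - C (aSeq d c j)} := by
      ext p
      simp only [Set.mem_ofPred_eq, Set.mem_singleton_iff, fIter, Nat.add_zero]
      refine ⟨fun ⟨h1, h2, h3⟩ => ?_, ?_⟩
      · exact eq_of_monic_of_associated h1 (monic_X_sub_C _)
          (h2.associated_of_dvd (irreducible_X_sub_C _) h3)
      · rintro rfl
        exact ⟨monic_X_sub_C _, irreducible_X_sub_C _, dvd_rfl⟩
    rw [h, Set.ncard_singleton]
    rfl
  | succ k ih =>
    have hmul := cofactor_mul (d := d) (c := c) k (j + k)
    have hdiv : (j + (k + 1) + (n - 1)) / n =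
        (j + k + (n - 1)) / n + if n ∣ j + k then 1 else 0 := by
      have h1 : j + (k + 1) + (n - 1) = (j + k + (n - 1)) + 1 := by omega
      have h2 : j + k + (n - 1) + 1 = (j + k) + n := by omega
      rw [h1, Nat.succ_div]
      simp only [h2, Nat.dvd_add_self_right]
    rw [hdiv]
    by_cases hi : n ∣ j + k
    · have ha := aSeq_eq_zero_of_dvd hn hi
      have h : {p : F[X] | p.Monic ∧ Irreducible p ∧
            p ∣ fIter d c (k + 1) - C (aSeq d c (j + (k + 1)))} =
          {p : F[X] | p.Monic ∧ Irreducible p ∧ p ∣ fIter d c k - C (aSeq d c (j + k))} := by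
        ext p
        simp only [Set.mem_ofPred_eq]
        refine and_congr_right fun _ => and_congr_right fun hp => ?_
        rw [← Nat.add_assoc, ← hmul, cofactor_of_aSeq_eq_zero hd.ne_zero k ha, ha]
        refine ⟨fun h => ?_, fun h => h.mul_left _⟩
        rcases hp.prime.dvd_or_dvd h with h | h
        · simpa using hp.prime.dvd_of_dvd_pow h
        · exact h
      rw [h, if_pos hi]
      omega
    · have h : {p : F[X] | p.Monic ∧ Irreducible p ∧
            p ∣ fIter d c (k + 1) - C (aSeq d c (j + (k + 1)))} =
          insert (cofactor d c k (j + k))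
            {p : F[X] | p.Monic ∧ Irreducible p ∧ p ∣ fIter d c k - C (aSeq d c (j + k))} := by
        ext p
        simp only [Set.mem_ofPred_eq, Set.mem_insert_iff]
        rw [← Nat.add_assoc, ← hmul]
        constructor
        · rintro ⟨h1, h2, h3⟩
          rcases h2.prime.dvd_or_dvd h3 with h | h
          · exact .inl (eq_of_monic_of_associated h1 (monic_cofactor hd.ne_zero _ _)
              (h2.associated_of_dvd (hirr k _ hi) h))
          · exact .inr ⟨h1, h2, h⟩
        · rintro (rfl | ⟨h1, h2, h3⟩)
          · exact ⟨monic_cofactor hd.ne_zero _ _, hirr k _ hi, dvd_mul_right _ _⟩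
          · exact ⟨h1, h2, h3.mul_left _⟩
      rw [h, if_neg hi, Set.ncard_insert_of_notMem
        (fun h => cofactor_not_dvd (hirr k _ hi) hdF (hne _ hi) h.2.2)
        (finite_setOf_monic_irreducible_dvd (monic_fIter_sub_C hd.ne_zero _ _).ne_zero)]
      omega

lemma ncard_factors_fIter (hd : d.Prime) (hdF : (d : F) ≠ 0) (hn0 : n ≠ 0)
    (hn : aSeq d c n = 0) (hne : ∀ i, ¬ n ∣ i → aSeq d c i ≠ 0)
    (hirr : ∀ k i, ¬ n ∣ i → Irreducible (cofactor d c k i)) (k : ℕ) :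
    {p : F[X] | p.Monic ∧ Irreducible p ∧ p ∣ fIter d c k}.ncard = k - k / n + 1 := by
  obtain ⟨m, rfl⟩ := Nat.exists_eq_succ_of_ne_zero hn0
  have h := ncard_factors_add hd hdF hn0 hn hne hirr (m * k) k
  have h0 : m * k + k = (m + 1) * k := by ring
  rw [h0, aSeq_eq_zero_of_dvd hn (dvd_mul_right _ _), C_0, sub_zero, Nat.succ_sub_one] at h
  have h1 : ((m + 1) * k + m) / (m + 1) = k := by
    rw [Nat.mul_add_div (by omega), Nat.div_eq_of_lt (by omega), Nat.add_zero]
  have h2 : (m * k + m) / (m + 1) = k - k / (m + 1) := by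
    have hmod := Nat.div_add_mod k (m + 1)
    have hlt := Nat.mod_lt k (Nat.succ_pos m)
    have hle := Nat.div_le_self k (m + 1)
    obtain ⟨e, he⟩ := Nat.exists_eq_add_of_le hle
    have : m * k + m = (m + 1) * e + (m - k % (m + 1)) := by
      set q := k / (m + 1)
      set r := k % (m + 1)
      obtain ⟨s, hs⟩ := Nat.exists_eq_add_of_le (Nat.lt_succ_iff.1 hlt)
      have : m - r = s := by omega
      rw [this]
      have e1 : e = m * q + r := by nlinarith
      have e2 : k = q + (m * q + r) := by omega
      nlinarith
    rw [this, Nat.mul_add_div (by omega), Nat.div_eq_of_lt (by omega)]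
    omega
  rw [h1, h2] at h
  simp only [Nat.succ_eq_add_one] at h ⊢
  have hle := Nat.div_le_self k (m + 1)
  omega

end Count

section Period

variable {d : ℕ}

lemma aeval_aPoly {A : Type*} [CommRing A] (c : A) (i : ℕ) :
    aeval c (aPoly d i) = aSeq d c i := by
  induction i with
  | zero => simp [aPoly, aSeq]
  | succ i ih => simp [aPoly, aSeq, ih]

lemma exists_derivative_aPoly (i : ℕ) :
    ∃ r : ℤ[X], derivative (aPoly d (i + 1)) = (d : ℤ[X]) * r + 1 :=
  ⟨aPoly d i ^ (d - 1) * derivative (aPoly d i), by simp [aPoly, derivative_pow, mul_assoc]⟩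

lemma monic_aPoly (hd : 2 ≤ d) (i : ℕ) : (aPoly d (i + 1)).Monic := by
  have h : (aPoly d (i + 1)).Monic ∧ (aPoly d (i + 1)).natDegree = d ^ i := by
    induction i with
    | zero => simp [aPoly, show d ≠ 0 by omega]
    | succ i ih =>
      rw [aPoly]
      have hdeg : (aPoly d (i + 1) ^ d).natDegree = d ^ (i + 1) := by
        rw [ih.1.natDegree_pow, ih.2, pow_succ']
      have hlt : (X : ℤ[X]).natDegree < (aPoly d (i + 1) ^ d).natDegree := by
        rw [hdeg, natDegree_X]
        exact Nat.one_lt_pow (by omega) (by omega)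
      exact ⟨(ih.1.pow d).add_of_left (degree_lt_degree hlt),
        by rw [natDegree_add_eq_left_of_natDegree_lt hlt, hdeg]⟩
  exact h.1

lemma isIntegral_of_aSeq_eq_zero {A : Type*} [CommRing A] {c : A} (hd : 2 ≤ d) {n : ℕ}
    (hn0 : n ≠ 0) (hn : aSeq d c n = 0) : IsIntegral ℤ c := by
  obtain ⟨m, rfl⟩ := Nat.exists_eq_succ_of_ne_zero hn0
  exact ⟨aPoly d (m + 1), monic_aPoly hd m, by rw [← aeval_def, aeval_aPoly, hn]⟩

lemma natCast_mul_ne_one_of_isIntegral {K : Type*} [Field K] [CharZero K] (hd : d.Prime) {z : K}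
    (hz : IsIntegral ℤ z) : (d : K) * z ≠ 1 := by
  intro h
  have hval : z = algebraMap ℚ K (1 / d) := by
    rw [eq_ratCast]
    push_cast
    rw [eq_div_iff (Nat.cast_ne_zero.2 hd.ne_zero), mul_comm, h]
  rw [hval, isIntegral_algebraMap_iff (algebraMap ℚ K).injective,
    IsIntegrallyClosed.isIntegral_iff] at hz
  obtain ⟨y, hy⟩ := hz
  rw [eq_div_iff (Nat.cast_ne_zero.2 hd.ne_zero), eq_intCast] at hy
  have hdvd : (d : ℤ) ∣ 1 := ⟨y, by rw [mul_comm]; exact_mod_cast hy.symm⟩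
  exact hd.one_lt.ne' (by exact_mod_cast Int.eq_one_of_dvd_one (by positivity) hdvd)

lemma aeval_derivative_aPoly_ne_zero (hd : d.Prime) {c : ℂ} (hc : IsIntegral ℤ c) (i : ℕ) :
    aeval c (derivative (aPoly d (i + 1))) ≠ 0 := by
  obtain ⟨r, hr⟩ := exists_derivative_aPoly (d := d) i
  rw [hr]
  intro h
  simp only [map_add, map_mul, map_natCast, map_one] at h
  have hint : IsIntegral ℤ (aeval c r) :=
    adjoin_le_integralClosure hc (aeval_mem_adjoin_singleton _ _)
  exact natCast_mul_ne_one_of_isIntegral hd hint.neg (by linear_combination -h)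

lemma rootMultiplicity_aPoly (hd : d.Prime) {c : ℂ} {i : ℕ} (hi : i ≠ 0) :
    ((aPoly d i).map (Int.castRingHom ℂ)).rootMultiplicity c =
      if aSeq d c i = 0 then 1 else 0 := by
  obtain ⟨m, rfl⟩ := Nat.exists_eq_succ_of_ne_zero hi
  have hroot : ((aPoly d (m + 1)).map (Int.castRingHom ℂ)).IsRoot c ↔ aSeq d c (m + 1) = 0 := by
    rw [IsRoot.def, ← aeval_aPoly, aeval_def, eval_map]
    rfl
  have hne : (aPoly d (m + 1)).map (Int.castRingHom ℂ) ≠ 0 :=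
    ((monic_aPoly hd.two_le m).map _).ne_zero
  split_ifs with h
  · refine le_antisymm ?_ ((rootMultiplicity_pos hne).2 (hroot.2 h))
    by_contra! hlt
    have h1 := ((one_lt_rootMultiplicity_iff_isRoot hne).1 hlt).2
    refine aeval_derivative_aPoly_ne_zero hd
      (isIntegral_of_aSeq_eq_zero hd.two_le hi h) m ?_
    rw [IsRoot.def, derivative_map, eval_map] at h1
    exact h1
  · exact rootMultiplicity_eq_zero fun h' => h (hroot.1 h')

lemma rootMultiplicity_prod {ι : Type*} (s : Finset ι) (f : ι → ℂ[X]) (e : ι → ℕ) (c : ℂ)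
    (h : ∀ i ∈ s, f i ≠ 0) :
    (∏ i ∈ s, f i ^ e i).rootMultiplicity c = ∑ i ∈ s, e i * (f i).rootMultiplicity c := by
  rw [← count_roots, roots_prod _ _ (Finset.prod_ne_zero_iff.2 fun i hi => pow_ne_zero _ (h i hi)),
    Multiset.count_bind]
  simp_rw [roots_pow, Multiset.count_nsmul, count_roots]
  rfl

lemma sum_moebius_mul_ite_dvd {n p : ℕ} (hn : 0 < n) :
    ∑ k ∈ n.divisors, ArithmeticFunction.moebius (n / k) * (if p ∣ k then 1 else 0) =
      if n = p then (1 : ℤ) else 0 := by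
  have h := (ArithmeticFunction.sum_eq_iff_sum_mul_moebius_eq (R := ℤ)
    (f := fun i => if i = p then 1 else 0) (g := fun m => if p ∣ m then 1 else 0)).1
    (fun m hm => by simp [hm.ne']) n hn
  rw [← h]
  exact (Nat.sum_divisorsAntidiagonal'
    fun a b => (ArithmeticFunction.moebius a : ℤ) * if p ∣ b then 1 else 0).symm

lemma exact_period_of_isGleasonRoot (hd : d.Prime) {n : ℕ} (hn : 0 < n) {c : ℂ}
    (hc : isGleasonRoot d n c) : aSeq d c n = 0 ∧ ∀ i, ¬ n ∣ i → aSeq d c i ≠ 0 := by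
  obtain ⟨g, hg, hgc⟩ := hc
  have hpos : ∀ k ∈ n.divisors, k ≠ 0 := fun k hk => (Nat.pos_of_mem_divisors hk).ne'
  have hne : ∀ k ∈ n.divisors, (aPoly d k).map (Int.castRingHom ℂ) ≠ 0 := fun k hk => by
    obtain ⟨m, rfl⟩ := Nat.exists_eq_succ_of_ne_zero (hpos k hk)
    exact ((monic_aPoly hd.two_le m).map _).ne_zero
  have h1 := congrArg (Polynomial.map (Int.castRingHom ℂ)) hg
  simp only [Polynomial.map_mul, Polynomial.map_prod, Polynomial.map_pow] at h1
  have hprod (e : ℕ → ℕ) : ∏ k ∈ n.divisors, (aPoly d k).map (Int.castRingHom ℂ) ^ e k ≠ 0 :=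
    Finset.prod_ne_zero_iff.2 fun k hk => pow_ne_zero _ (hne k hk)
  have hmulne : g.map (Int.castRingHom ℂ) * _ ≠ 0 := h1 ▸ hprod _
  have hgpos : 0 < (g.map (Int.castRingHom ℂ)).rootMultiplicity c := by
    refine (rootMultiplicity_pos (left_ne_zero_of_mul hmulne)).2 ?_
    rw [IsRoot.def, eval_map]
    exact hgc
  have h2 := congrArg (rootMultiplicity c) h1
  rw [rootMultiplicity_mul hmulne, rootMultiplicity_prod _ _ _ _ hne,
    rootMultiplicity_prod _ _ _ _ hne] at h2
  have h3 : 0 < ∑ k ∈ n.divisors,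
      ArithmeticFunction.moebius (n / k) * (if aSeq d c k = 0 then (1 : ℤ) else 0) := by
    have h4 : ∑ k ∈ n.divisors,
        ArithmeticFunction.moebius (n / k) * (if aSeq d c k = 0 then (1 : ℤ) else 0) =
        (g.map (Int.castRingHom ℂ)).rootMultiplicity c := by
      zify at h2
      rw [← sub_eq_iff_eq_add.2 h2.symm, ← Finset.sum_sub_distrib]
      refine Finset.sum_congr rfl fun k hk => ?_
      rw [← sub_mul, rootMultiplicity_aPoly hd (hpos k hk)]
      push_cast
      congr 1
      omega
    rw [h4]
    exact_mod_cast hgpos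
  have hex : ∃ p, p ≠ 0 ∧ aSeq d c p = 0 := by
    by_contra! hall
    rw [Finset.sum_eq_zero fun k hk => by rw [if_neg (hall k (hpos k hk)), mul_zero]] at h3
    exact h3.false
  classical
  set p := Nat.find hex with hp
  obtain ⟨hp0, hpz⟩ := Nat.find_spec hex
  have hdvd (k : ℕ) : aSeq d c k = 0 ↔ p ∣ k := by
    refine ⟨fun h => ?_, aSeq_eq_zero_of_dvd hpz⟩
    rw [← aSeq_mod_of_eq_zero hpz] at h
    by_contra hk
    exact Nat.find_min hex (Nat.mod_lt k (Nat.pos_of_ne_zero hp0))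
      ⟨fun h0 => hk (Nat.dvd_of_mod_eq_zero h0), h⟩
  simp only [hdvd] at h3
  rw [sum_moebius_mul_ite_dvd hn] at h3
  have hnp : n = p := by
    by_contra h
    simp [h] at h3
  rw [hnp]
  exact ⟨hpz, fun i hi => (hdvd i).not.2 hi⟩

end Period
section NumberField

open NumberField

lemma notMem_sq_of_aSeq_eq_zero {K : Type*} [Field K] [NumberField K] {d n : ℕ} (hd : d.Prime)
    (hn0 : n ≠ 0) {c : 𝓞 K} (hn : aSeq d c n = 0)
    (hc : Algebra.adjoin ℚ {algebraMap (𝓞 K) K c} = ⊤) {P : Ideal (𝓞 K)} [P.IsPrime]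
    (hdP : (d : 𝓞 K) ∈ P) : (d : 𝓞 K) ∉ P ^ 2 := by
  intro h
  have : (Ideal.span {(d : ℤ)}).IsMaximal :=
    PrincipalIdealRing.isMaximal_of_irreducible (Nat.prime_iff_prime_int.1 hd).irreducible
  have h1 : P ^ 2 ∣ (Ideal.span {(d : ℤ)}).map (algebraMap ℤ (𝓞 K)) := by
    rw [Ideal.dvd_iff_le, Ideal.map_span, Set.image_singleton, Ideal.span_le,
      Set.singleton_subset_iff]
    simpa using h
  have h2 := pow_sub_one_dvd_differentIdeal ℤ P 2
    (by simpa using hd.ne_zero) h1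
  have h3 := Ideal.le_of_dvd h2 (aeval_derivative_mem_differentIdeal ℤ ℚ K c hc)
  rw [Nat.add_one_sub_one, pow_one] at h3
  obtain ⟨m, rfl⟩ := Nat.exists_eq_succ_of_ne_zero hn0
  obtain ⟨q, hq⟩ := minpoly.isIntegrallyClosed_dvd (Algebra.IsIntegral.isIntegral (R := ℤ) c)
    ((aeval_aPoly c (m + 1)).trans hn)
  obtain ⟨r, hr⟩ := exists_derivative_aPoly (d := d) m
  have h4 := congrArg (fun p => aeval c (derivative p)) hq
  simp only [hr, derivative_mul, map_add, map_mul, minpoly.aeval, map_natCast, map_one,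
    zero_mul, add_zero] at h4
  refine (inferInstance : P.IsPrime).one_notMem ?_
  rw [← eq_sub_iff_add_eq'] at h4
  rw [h4]
  exact P.sub_mem (P.mul_mem_right _ h3) (P.mul_mem_right _ hdP)

lemma irreducible_cofactor_numberField {K : Type*} [Field K] [NumberField K] [A : Algebra ℚ K]
    {d n : ℕ} (hd : d.Prime) (hn0 : n ≠ 0) {c : K} (hn : aSeq d c n = 0)
    (hne : ∀ i, ¬ n ∣ i → aSeq d c i ≠ 0) (hc : Algebra.adjoin ℚ {c} = ⊤) (k i : ℕ)
    (hi : ¬ n ∣ i) : Irreducible (cofactor d c k i) := by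
  obtain rfl := Subsingleton.elim A DivisionRing.toRatAlgebra
  obtain ⟨x, rfl⟩ : ∃ x : 𝓞 K, algebraMap (𝓞 K) K x = c :=
    ⟨⟨c, isIntegral_of_aSeq_eq_zero hd.two_le hn0 hn⟩, rfl⟩
  simp only [← map_aSeq, ne_eq, FaithfulSMul.algebraMap_eq_zero_iff] at hn hne
  have hnu : ¬ IsUnit (d : 𝓞 K) := fun hu => by
    obtain ⟨z, hz⟩ := hu.exists_right_inv
    refine natCast_mul_ne_one_of_isIntegral hd (RingOfIntegers.isIntegral_coe z) ?_
    simpa using congrArg (algebraMap (𝓞 K) K) hz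
  obtain ⟨P, hP, hdP⟩ := exists_max_ideal_of_mem_nonunits hnu
  have := hP.isPrime
  rw [← map_cofactor, ← (monic_cofactor hd.ne_zero k i).irreducible_iff_irreducible_map_fraction_map]
  exact irreducible_cofactor hd hdP (notMem_sq_of_aSeq_eq_zero hd hn0 hn hc hdP) hn0 hn hne k hi

end NumberField

/-- For a Gleason parameter `c₀` of period `n ≥ 2` and `K = ℚ(c₀)`, the
`k`-th iterate `f_{d,c₀}^k` has exactly `k - ⌊k/n⌋ + 1` distinct irreducible factors over `K`
(counted without multiplicity, i.e. monic irreducible divisors). -/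
theorem stmt3 (d : ℕ) (hd : Nat.Prime d) (n : ℕ) (hn : 2 ≤ n)
    (c₀ : ℂ) (hc₀ : isGleasonRoot d n c₀)
    (k : ℕ) (hk : 1 ≤ k) :
    {p : Polynomial ℚ⟮c₀⟯ | p.Monic ∧ Irreducible p ∧
        p ∣ fIter d (IntermediateField.AdjoinSimple.gen ℚ c₀) k}.ncard
      = k - k / n + 1 := by
  have hn0 : n ≠ 0 := by omega
  obtain ⟨h0, hne⟩ := exact_period_of_isGleasonRoot hd (by omega) hc₀
  have hint : IsIntegral ℚ c₀ := (isIntegral_of_aSeq_eq_zero hd.two_le hn0 h0).tower_top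
  have : FiniteDimensional ℚ ℚ⟮c₀⟯ := adjoin.finiteDimensional hint
  have : NumberField ℚ⟮c₀⟯ := ⟨⟩
  have hmap (i : ℕ) : aSeq d (AdjoinSimple.gen ℚ c₀) i = 0 ↔ aSeq d c₀ i = 0 := by
    rw [← map_eq_zero (algebraMap ℚ⟮c₀⟯ ℂ), map_aSeq, AdjoinSimple.algebraMap_gen]
  have hgen := (adjoin.powerBasis hint).adjoin_gen_eq_top
  rw [adjoin.powerBasis_gen] at hgen
  have h0' := (hmap n).2 h0
  have hne' : ∀ i, ¬ n ∣ i → aSeq d (AdjoinSimple.gen ℚ c₀) i ≠ 0 :=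
    fun i hi => (hmap i).not.2 (hne i hi)
  exact ncard_factors_fIter hd (Nat.cast_ne_zero.2 hd.ne_zero) hn0 h0' hne'
    (irreducible_cofactor_numberField hd hn0 h0' hne' hgen) k
end
end
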